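/- arXiv:2005.09990 — 5 statements merged into one kernel-verified Lean document; each statement's English description precedes it below -/
import Mathlib

section
/- Let q be a prime power, V = F_q^n, and let Q : V → F_q be a quadratic form whose associated polar bilinear form f(u, v) = Q(u + v) − Q(u) − Q(v) is nondegenerate. Let W ≤ V be a linear subspace of codimension s, let v_0 ∈ V, and let x ∈ F_q. Then the number of vectors v in the affine subspace v_0 + W with Q(v) = x differs from q^{n−s−1} by at most q^{n/2}; that is, |#{v ∈ v_0 + W : Q(v) = x} − q^{n−s−1}| ≤ q^{n/2}. -/
open scoped ComplexConjugate

/-- A nontrivial additive character of a field sums to zero along a nonzero linear functional. -/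
theorem AddChar.sum_comp_linearMap_eq_zero {F M : Type*} [Field F] [AddCommGroup M] [Module F M]
    [Fintype M] {ψ : AddChar F ℂ} (hψ : ψ ≠ 1) {L : M →ₗ[F] F} (hL : L ≠ 0) :
    ∑ w, ψ (L w) = 0 := by
  obtain ⟨a, ha⟩ := AddChar.ne_one_iff.1 hψ
  obtain ⟨w, rfl⟩ := LinearMap.surjective hL a
  exact AddChar.sum_eq_zero_of_ne_one (ψ := ψ.compAddMonoidHom L.toAddMonoidHom)
    (AddChar.ne_one_iff.2 ⟨w, ha⟩)

/-- Weyl differencing for a quadratic form: the square of the norm of the exponential sum over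
a coset of `W` is at most `|W|` times the size of the orthogonal complement of `W`. -/
theorem QuadraticMap.norm_sum_addChar_sq_le {F V : Type*} [Field F] [Fintype F] [AddCommGroup V]
    [Module F V] [Fintype V] (Q : QuadraticForm F V) (W : Submodule F V) (v₀ : V)
    {ψ : AddChar F ℂ} (hψ : ψ ≠ 1) [Fintype W] :
    ‖∑ w : W, ψ (Q (v₀ + w))‖ ^ 2 ≤
      Nat.card W * Nat.card (LinearMap.BilinForm.orthogonal Q.polarBilin W) := by
  classical
  set B : LinearMap.BilinForm F V := Q.polarBilin
  set S := ∑ w : W, ψ (Q (v₀ + w)) with hS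
  have hdiff (h w : W) : ψ (Q (v₀ + ((w + h : W) : V))) * conj (ψ (Q (v₀ + w))) =
      ψ (Q h + B v₀ h) * ψ ((B h ∘ₗ W.subtype) w) := by
    rw [← AddChar.map_neg_eq_conj, ← AddChar.map_add_eq_mul, ← AddChar.map_add_eq_mul]
    congr 1
    have h1 := QuadraticMap.map_add Q (v₀ + (w : V)) h
    have h2 : B (v₀ + (w : V)) h = B v₀ h + B w h := by simp
    have h3 : B w h = B h w := QuadraticMap.polar_comm Q w h
    rw [Submodule.coe_add, ← add_assoc, h1]
    change _ + B (v₀ + (w : V)) h + _ = _ + B h w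
    rw [h2, h3]
    ring
  have hSS : S * conj S =
      ∑ h : W, ψ (Q h + B v₀ h) * ∑ w : W, ψ ((B h ∘ₗ W.subtype) w) := by
    simp_rw [Finset.mul_sum, ← hdiff]
    rw [Finset.sum_comm, hS, map_sum, Finset.mul_sum]
    refine Finset.sum_congr rfl fun w _ => ?_
    rw [← Finset.sum_mul]
    congr 1
    exact (Fintype.sum_equiv (Equiv.addLeft w) _ _ fun h => rfl).symm
  have hterm (h : W) : ‖ψ (Q h + B v₀ h) * ∑ w : W, ψ ((B h ∘ₗ W.subtype) w)‖ ≤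
      if (h : V) ∈ B.orthogonal W then (Nat.card W : ℝ) else 0 := by
    rw [norm_mul, AddChar.norm_apply, one_mul]
    split_ifs with hh
    · refine (norm_sum_le _ _).trans ?_
      simp [AddChar.norm_apply]
    · rw [AddChar.sum_comp_linearMap_eq_zero hψ, norm_zero]
      intro h0
      refine hh (LinearMap.BilinForm.mem_orthogonal_iff.2 fun w hw => ?_)
      exact (QuadraticMap.polar_comm Q w h).trans (LinearMap.congr_fun h0 ⟨w, hw⟩)
  have hcard : (Finset.univ.filter fun h : W => (h : V) ∈ B.orthogonal W).card ≤
      Nat.card (B.orthogonal W) := by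
    rw [← Fintype.card_subtype, ← Nat.card_eq_fintype_card]
    exact Nat.card_le_card_of_injective
      (fun h : {h : W // (h : V) ∈ B.orthogonal W} => (⟨h.1, h.2⟩ : B.orthogonal W))
      fun a b hab => Subtype.ext (Subtype.ext (congrArg (fun z : B.orthogonal W => (z : V)) hab))
  calc ‖S‖ ^ 2 = ‖S * conj S‖ := by rw [norm_mul, RCLike.norm_conj, pow_two]
    _ ≤ ∑ h : W, if (h : V) ∈ B.orthogonal W then (Nat.card W : ℝ) else 0 := by
        rw [hSS]
        exact (norm_sum_le _ _).trans (Finset.sum_le_sum fun h _ => hterm h)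
    _ = (Finset.univ.filter fun h : W => (h : V) ∈ B.orthogonal W).card * Nat.card W := by
        rw [← Finset.sum_filter, Finset.sum_const, nsmul_eq_mul]
    _ ≤ Nat.card W * Nat.card (B.orthogonal W) := by
        rw [mul_comm]
        gcongr

/-- If the polar form of `Q` is nondegenerate, then exponential sums of `Q` over cosets of
subspaces exhibit square-root cancellation relative to the ambient space. -/
theorem QuadraticMap.norm_sum_addChar_le {F V : Type*} [Field F] [Fintype F] [AddCommGroup V]
    [Module F V] [Fintype V] (Q : QuadraticForm F V)
    (hQ : ∀ v, (∀ u, QuadraticMap.polar Q v u = 0) → v = 0) (W : Submodule F V) (v₀ : V)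
    {ψ : AddChar F ℂ} (hψ : ψ ≠ 1) [Fintype W] :
    ‖∑ w : W, ψ (Q (v₀ + w))‖ ≤ (Fintype.card F : ℝ) ^ ((Module.finrank F V : ℝ) / 2) := by
  have hnd : LinearMap.BilinForm.Nondegenerate Q.polarBilin :=
    ⟨fun v hv => hQ v hv, fun v hv => hQ v fun u => (QuadraticMap.polar_comm Q v u).trans (hv u)⟩
  have hrank := LinearMap.BilinForm.finrank_orthogonal hnd W
  have hle := W.finrank_le
  refine (sq_le_sq₀ (norm_nonneg _) (by positivity)).1 ((Q.norm_sum_addChar_sq_le W v₀ hψ).trans_eq ?_)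
  rw [Module.natCard_eq_pow_finrank (K := F) (V := W), Module.natCard_eq_pow_finrank (K := F)
    (V := LinearMap.BilinForm.orthogonal Q.polarBilin W), hrank, Nat.card_eq_fintype_card,
    ← Nat.cast_mul, ← pow_add, Nat.add_sub_cancel' hle, ← Real.rpow_mul_natCast (by positivity),
    Nat.cast_two, div_mul_cancel₀ _ two_ne_zero, Real.rpow_natCast, Nat.cast_pow]

/-- Fourier expansion of a level-set count by the shifts of a nontrivial additive character. -/
theorem AddChar.card_mul_card_fiber {F ι : Type*} [Field F] [Fintype F] [Fintype ι]
    {ψ : AddChar F ℂ} (hψ : ψ ≠ 1) (g : ι → F) (x : F) :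
    (Fintype.card F : ℂ) * Nat.card {i // g i = x} = ∑ t : F, ∑ i, ψ (t * (g i - x)) := by
  classical
  rw [Finset.sum_comm]
  simp_rw [AddChar.sum_mulShift _ (AddChar.IsPrimitive.of_ne_one hψ), sub_eq_zero]
  rw [Nat.card_eq_fintype_card, Fintype.card_subtype]
  push_cast
  rw [← Finset.sum_filter, Finset.sum_const, nsmul_eq_mul, mul_comm]

/-- **Counting solutions of `Q(v) = x` in an affine subspace** (Lemma 2.2).
Let `Q` be a quadratic form on `V = F_q^n` whose polar bilinear form is
nondegenerate, let `v₀ + W` be an affine subspace with `W` of codimension `s`,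
and let `x ∈ F_q`. Then the number of `v ∈ v₀ + W` with `Q(v) = x` is within
`q^{n/2}` of `q^{n-s-1}`. -/
theorem stmt4 (F : Type) [Field F] [Fintype F] (n s : ℕ) (hs : s ≤ n)
    (Q : QuadraticForm F (Fin n → F))
    (hQ : ∀ v : Fin n → F, (∀ u : Fin n → F, QuadraticMap.polar (⇑Q) v u = 0) → v = 0)
    (W : Submodule F (Fin n → F)) (hW : Module.finrank F ↥W = n - s)
    (v₀ : Fin n → F) (x : F) :
    |(Nat.card {v : Fin n → F // v - v₀ ∈ W ∧ Q v = x} : ℝ) -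
        (Fintype.card F : ℝ) ^ ((n : ℝ) - s - 1)| ≤
      (Fintype.card F : ℝ) ^ ((n : ℝ) / 2) := by
  classical
  obtain ⟨ψ, hψ⟩ := AddChar.exists_apply_ne_zero.2 (one_ne_zero : (1 : F) ≠ 0)
  replace hψ : ψ ≠ 1 := AddChar.ne_one_iff.2 ⟨1, hψ⟩
  have hq : (0 : ℝ) < Fintype.card F := by exact_mod_cast Fintype.card_pos
  have hN : Nat.card {v : Fin n → F // v - v₀ ∈ W ∧ Q v = x} =
      Nat.card {w : W // Q (v₀ + w) = x} := Nat.card_congr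
    { toFun := fun v => ⟨⟨v.1 - v₀, v.2.1⟩, by simpa using v.2.2⟩
      invFun := fun w => ⟨v₀ + w.1, by simp, w.2⟩
      left_inv := fun v => by simp
      right_inv := fun w => by simp }
  have hmain : (Fintype.card F : ℝ) ^ ((n : ℝ) - s - 1) =
      (Fintype.card W : ℝ) / Fintype.card F := by
    rw [Real.rpow_sub_one hq.ne', ← Nat.cast_sub hs, Real.rpow_natCast,
      Module.card_eq_pow_finrank (K := F) (V := W), hW, Nat.cast_pow]
  have hsum := AddChar.card_mul_card_fiber hψ (fun w : W => Q (v₀ + w)) x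
  rw [← Finset.add_sum_erase _ _ (Finset.mem_univ (0 : F))] at hsum
  simp only [zero_mul, AddChar.map_zero_eq_one, Finset.sum_const, Finset.card_univ,
    nsmul_eq_mul, mul_one] at hsum
  have hshift (t : F) (ht : t ≠ 0) :
      ‖∑ w : W, ψ (t * (Q (v₀ + w) - x))‖ ≤ (Fintype.card F : ℝ) ^ ((n : ℝ) / 2) := by
    have hfac (w : W) : ψ (t * (Q (v₀ + w) - x)) =
        ψ (-(t * x)) * ψ.mulShift t (Q (v₀ + w)) := by
      rw [AddChar.mulShift_apply, ← AddChar.map_add_eq_mul]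
      congr 1
      ring
    simp_rw [hfac]
    rw [← Finset.mul_sum, norm_mul, AddChar.norm_apply, one_mul]
    simpa using Q.norm_sum_addChar_le hQ W v₀ (AddChar.IsPrimitive.of_ne_one hψ ht)
  rw [hN, hmain]
  set N := Nat.card {w : W // Q (v₀ + w) = x}
  have hscaled : |(Fintype.card F : ℝ) * N - Fintype.card W| ≤
      Fintype.card F * (Fintype.card F : ℝ) ^ ((n : ℝ) / 2) := by
    rw [← Real.norm_eq_abs, ← Complex.norm_real]
    push_cast
    rw [hsum, add_sub_cancel_left]
    refine (norm_sum_le _ _).trans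
      ((Finset.sum_le_sum fun t ht => hshift t (Finset.ne_of_mem_erase ht)).trans ?_)
    rw [Finset.sum_const, nsmul_eq_mul]
    gcongr
    exact Finset.card_le_univ _
  refine le_of_mul_le_mul_left ?_ hq
  rwa [← abs_of_pos hq, ← abs_mul, abs_of_pos hq, mul_sub, mul_div_cancel₀ _ hq.ne']
end

section
/- Let q be a prime power, let G be any subgroup of GL_n(q), and let g ∈ G. Then the centralizer of g in G has cardinality at most q^{n·(n − supp g)}, where supp g is the support of g. -/
/-- The support of `g ∈ GL_n(q)`: the minimum over `λ` in the algebraic closure of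
`F_q` of `rank(g - λ·1)`, computed over the algebraic closure. -/
noncomputable def matrixSupp {n : ℕ} {F : Type} [Field F]
    (g : Matrix (Fin n) (Fin n) F) : ℕ :=
  ⨅ lam : AlgebraicClosure F,
    (g.map (algebraMap F (AlgebraicClosure F)) -
      lam • (1 : Matrix (Fin n) (Fin n) (AlgebraicClosure F))).rank

open Module

/-- The space of linear maps `T : V → W` intertwining an endomorphism `f` of `V` with an
endomorphism `h` of `W`. -/
def intertwiners {K V W : Type*} [Field K] [AddCommGroup V] [Module K V] [AddCommGroup W]
    [Module K W] (f : End K V) (h : End K W) : Submodule K (V →ₗ[K] W) where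
  carrier := {T | T ∘ₗ f = h ∘ₗ T}
  add_mem' {S T} hS hT := by
    simp only [Set.mem_ofPred_eq] at *
    rw [LinearMap.add_comp, LinearMap.comp_add, hS, hT]
  zero_mem' := by simp
  smul_mem' c T hT := by
    simp only [Set.mem_ofPred_eq] at *
    rw [LinearMap.smul_comp, LinearMap.comp_smul, hT]

theorem mem_intertwiners {K V W : Type*} [Field K] [AddCommGroup V] [Module K V]
    [AddCommGroup W] [Module K W] {f : End K V} {h : End K W} {T : V →ₗ[K] W} :
    T ∈ intertwiners f h ↔ ∀ v, T (f v) = h (T v) :=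
  LinearMap.ext_iff

/-- Intertwiners with values in the `c`-eigenspace of `h` factor through the cokernel of
`f - c`, which has the same dimension as the `c`-eigenspace of `f`. -/
theorem finrank_intertwiners_inf_eigenspace_le {K V W : Type*} [Field K] [AddCommGroup V]
    [Module K V] [AddCommGroup W] [Module K W] [FiniteDimensional K V] [FiniteDimensional K W]
    (f : End K V) (h : End K W) (c : K) (S : Submodule K (V →ₗ[K] W))
    (hS : S ≤ intertwiners f h) (hSc : ∀ T ∈ S, ∀ v, h (T v) = c • T v) :
    finrank K S ≤ finrank K (LinearMap.ker (f - c • 1)) *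
      finrank K (LinearMap.ker (h - c • 1)) := by
  set R := LinearMap.range (f - c • (1 : End K V))
  set E := LinearMap.ker (h - c • (1 : End K W))
  let Φ : ((V ⧸ R) →ₗ[K] E) →ₗ[K] (V →ₗ[K] W) :=
    (LinearMap.lcomp K W R.mkQ) ∘ₗ (LinearMap.llcomp K (V ⧸ R) E W E.subtype)
  have hle : S ≤ LinearMap.range Φ := by
    intro T hT
    have hR : R ≤ LinearMap.ker (T.codRestrict E fun v => by simp [E, hSc T hT v]) := by
      rintro _ ⟨v, rfl⟩
      rw [LinearMap.mem_ker]
      ext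
      simp [mem_intertwiners.1 (hS hT), hSc T hT v]
    refine ⟨R.liftQ _ hR, ?_⟩
    ext v
    simp [Φ]
  have hcoker : finrank K (V ⧸ R) = finrank K (LinearMap.ker (f - c • (1 : End K V))) := by
    have h₁ := R.finrank_quotient_add_finrank
    have h₂ : finrank K R + _ = _ :=
      LinearMap.finrank_range_add_finrank_ker (f - c • (1 : End K V))
    omega
  calc finrank K S ≤ finrank K (LinearMap.range Φ) := Submodule.finrank_mono hle
    _ ≤ finrank K ((V ⧸ R) →ₗ[K] E) := LinearMap.finrank_range_le Φ
    _ = _ := by rw [finrank_linearMap, hcoker]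

/-- If every eigenspace of `f` has dimension at most `m`, then the space of maps from `V` to `W`
intertwining `f` with any endomorphism of `W` has dimension at most `m * dim W`. -/
theorem finrank_intertwiners_le {K V : Type*} [Field K] [IsAlgClosed K] [AddCommGroup V]
    [Module K V] [FiniteDimensional K V] (f : End K V) (m : ℕ)
    (hm : ∀ c : K, finrank K (LinearMap.ker (f - c • 1)) ≤ m) {W : Type*} [AddCommGroup W]
    [Module K W] [FiniteDimensional K W] (h : End K W) :
    finrank K (intertwiners f h) ≤ m * finrank K W := by
  induction hd : finrank K W using Nat.strong_induction_on generalizing W with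
  | _ d ih =>
  subst hd
  rcases subsingleton_or_nontrivial W with hW | hW
  · simp [finrank_zero_of_subsingleton]
  obtain ⟨c, hc⟩ := Module.End.exists_eigenvalue h
  set a : End K W := h - c • 1
  have hker : 0 < finrank K (LinearMap.ker a) := by
    obtain ⟨w, hw⟩ := hc.exists_hasEigenvector
    have hwa : w ∈ LinearMap.ker a := by simp [a, hw.apply_eq_smul]
    exact finrank_pos_iff_exists_ne_zero.2
      ⟨⟨w, hwa⟩, fun h0 => hw.2 (congrArg Subtype.val h0)⟩
  have hdim := LinearMap.finrank_range_add_finrank_ker a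
  have hcomm : ∀ w, h (a w) = a (h w) := fun w => by simp [a]
  have hinv : ∀ w ∈ LinearMap.range a, h w ∈ LinearMap.range a := by
    rintro _ ⟨w, rfl⟩
    exact ⟨h w, (hcomm w).symm⟩
  let Ψ : intertwiners f h →ₗ[K] (V →ₗ[K] LinearMap.range a) :=
    (LinearMap.llcomp K V W (LinearMap.range a) a.rangeRestrict) ∘ₗ (intertwiners f h).subtype
  have hrange : finrank K (LinearMap.range Ψ) ≤ m * finrank K (LinearMap.range a) := by
    refine (Submodule.finrank_mono ?_).trans (ih _ (by omega) (h.restrict hinv) rfl)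
    rintro _ ⟨T, rfl⟩
    rw [mem_intertwiners]
    intro v
    ext
    simp [Ψ, mem_intertwiners.1 T.2, hcomm]
  have hkerΨ : finrank K (LinearMap.ker Ψ) ≤ m * finrank K (LinearMap.ker a) := by
    rw [← Submodule.finrank_map_subtype_eq]
    refine (finrank_intertwiners_inf_eigenspace_le f h c _ (Submodule.map_subtype_le _ _)
      ?_).trans (Nat.mul_le_mul_right _ (hm c))
    rintro _ ⟨T, hT, rfl⟩ v
    have hv := congrArg Subtype.val (LinearMap.congr_fun (LinearMap.mem_ker.1 hT) v)
    simpa [Ψ, a, sub_eq_zero] using hv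
  rw [← LinearMap.finrank_range_add_finrank_ker Ψ, ← hdim, mul_add]
  exact Nat.add_le_add hrange hkerΨ

/-- The matrices that commute with `g`, as a linear subspace, do not gain dimension
when the intertwiners are taken over an extension field. -/
theorem finrank_centralizer_le_finrank_intertwiners {n F K : Type*} [Fintype n] [DecidableEq n]
    [Field F] [Field K] [Algebra F K] (g : Matrix n n F) :
    finrank F (Subalgebra.centralizer F {g}) ≤
      finrank K (intertwiners (Matrix.toLin' (g.map (algebraMap F K)))
        (Matrix.toLin' (g.map (algebraMap F K)))) := by
  let C := Subalgebra.centralizer F {g}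
  let b := finBasis F C
  have hb : LinearIndependent F fun i => (b i : Matrix n n F) :=
    b.linearIndependent.map' C.val.toLinearMap (LinearMap.ker_eq_bot.2 Subtype.val_injective)
  let e : Matrix n n F ≃ₗ[F] (n × n → F) := (LinearEquiv.curry F F n n).symm
  have hbK : LinearIndependent K fun i => (b i : Matrix n n F).map (algebraMap F K) := by
    have h₁ : LinearIndependent F fun i => e (b i) := hb.map' e.toLinearMap e.ker
    have h₂ := (linearIndependent_algebraMap_comp_iff (S := K)).2 h₁
    exact h₂.map' (LinearEquiv.curry K K n n).toLinearMap (LinearEquiv.ker _)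
  have hbT : LinearIndependent K fun i =>
      Matrix.toLin' ((b i : Matrix n n F).map (algebraMap F K)) :=
    hbK.map' Matrix.toLin'.toLinearMap (LinearEquiv.ker _)
  have hmem : ∀ i, Matrix.toLin' ((b i : Matrix n n F).map (algebraMap F K)) ∈
      intertwiners (Matrix.toLin' (g.map (algebraMap F K)))
        (Matrix.toLin' (g.map (algebraMap F K))) := by
    intro i
    have hi : g * (b i : Matrix n n F) = b i * g := (b i).2 g rfl
    change _ ∘ₗ _ = _ ∘ₗ _
    rw [← Matrix.toLin'_mul, ← Matrix.toLin'_mul, ← Matrix.map_mul, ← Matrix.map_mul, hi]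
  have hli : LinearIndependent K fun i => (⟨_, hmem i⟩ : intertwiners
      (Matrix.toLin' (g.map (algebraMap F K))) (Matrix.toLin' (g.map (algebraMap F K)))) :=
    LinearIndependent.of_comp (Submodule.subtype _) hbT
  simpa using hli.fintype_card_le_finrank

theorem finrank_ker_toLin'_sub_le {n : ℕ} {F : Type} [Field F] (g : Matrix (Fin n) (Fin n) F)
    (c : AlgebraicClosure F) :
    finrank (AlgebraicClosure F) (LinearMap.ker
      (Matrix.toLin' (g.map (algebraMap F (AlgebraicClosure F))) - c • (1 : End _ _))) ≤
      n - matrixSupp g := by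
  have hsupp : matrixSupp g ≤ (g.map (algebraMap F (AlgebraicClosure F)) -
      c • (1 : Matrix (Fin n) (Fin n) (AlgebraicClosure F))).rank :=
    ciInf_le (OrderBot.bddBelow _) c
  have hlin : Matrix.toLin' (g.map (algebraMap F (AlgebraicClosure F))) - c • (1 : End _ _) =
      Matrix.toLin' (g.map (algebraMap F (AlgebraicClosure F)) - c • 1) := by
    rw [map_sub, map_smul, Matrix.toLin'_one]
    rfl
  have hdim := LinearMap.finrank_range_add_finrank_ker
    (Matrix.toLin' (g.map (algebraMap F (AlgebraicClosure F)) - c • 1))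
  rw [Matrix.rank, ← Matrix.toLin'_apply'] at hsupp
  rw [finrank_fin_fun] at hdim
  rw [hlin]
  omega

/-- **Support bounds the centralizer** (Lemma 2.4). For any subgroup
`G ≤ GL_n(q)` and any `g ∈ G`, the centralizer of `g` in `G` has at most
`q^{n(n - supp g)}` elements. -/
theorem stmt5 (F : Type) [Field F] [Fintype F] (n : ℕ)
    (G : Subgroup (GL (Fin n) F)) (g : ↥G) :
    Nat.card {h : ↥G // h * g = g * h} ≤
      Fintype.card F ^
        (n * (n - matrixSupp (((g : GL (Fin n) F) : Matrix (Fin n) (Fin n) F)))) := by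
  set A : Matrix (Fin n) (Fin n) F := ((g : GL (Fin n) F) : Matrix (Fin n) (Fin n) F)
  let ι : {h : ↥G // h * g = g * h} → Subalgebra.centralizer F {A} := fun h =>
    ⟨((h.1 : GL (Fin n) F) : Matrix (Fin n) (Fin n) F), by
      rintro _ rfl
      exact (congrArg (fun x : ↥G => ((x : GL (Fin n) F) : Matrix (Fin n) (Fin n) F)) h.2).symm⟩
  have hι : Function.Injective ι := fun x y hxy =>
    Subtype.ext (Subtype.ext (Units.ext (congrArg Subtype.val hxy)))
  have hfin := (finrank_centralizer_le_finrank_intertwiners (K := AlgebraicClosure F) A).trans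
    (finrank_intertwiners_le _ _ (finrank_ker_toLin'_sub_le A) _)
  rw [finrank_fin_fun, mul_comm] at hfin
  calc Nat.card {h : ↥G // h * g = g * h}
      ≤ Nat.card (Subalgebra.centralizer F {A}) := Nat.card_le_card_of_injective ι hι
    _ = Fintype.card F ^ finrank F (Subalgebra.centralizer F {A}) := by
      rw [Module.natCard_eq_pow_finrank (K := F), Nat.card_eq_fintype_card]
    _ ≤ _ := Nat.pow_le_pow_right Fintype.card_pos hfin
end

section
/- Let q be a prime power, n and k positive integers, and let G be any group with SL_n(q) ≤ G ≤ GL_n(q). Let V = F_q^n and let U ≤ V be a subspace of dimension r with 1 ≤ r ≤ n − 2. Let w ∈ F_k be a nontrivial word of reduced length ℓ with ℓ ≤ (n/2 − 2)/r. Choose x_1, …, x_k independently and uniformly at random from G. Then the probability that w(x_1, …, x_k)·U = U is at most ( C_{q^r} · q^{ℓr} / (q^{n−ℓr−1} − q^{ℓr} − q^{n/2}) )^r, where C_{q^r} = 1 + (1 − q^{−r})^{−1}. -/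
open Module Submodule

section Histories

variable {F V G ι : Type*} [Field F] [AddCommGroup V] [Module F V] [Group G]

/-- The formal inverse of a letter of the free group. -/
def letterInv (a : ι × Bool) : ι × Bool := (a.1, !a.2)

@[simp] lemma letterInv_letterInv (a : ι × Bool) : letterInv (letterInv a) = a := by
  simp [letterInv]

lemma letterInv_ne (a : ι × Bool) : letterInv a ≠ a := by
  rcases a with ⟨i, b⟩
  simp [letterInv]

/-- The group element by which a letter acts. Since a word is read from its first letter, this is
the inverse of the image of the letter, and a word acts by the inverse of its image. -/
def letterVal (x : ι → G) (a : ι × Bool) : G := cond a.2 (x a.1)⁻¹ (x a.1)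

lemma letterVal_letterInv (x : ι → G) (a : ι × Bool) :
    letterVal x (letterInv a) = (letterVal x a)⁻¹ := by
  rcases a with ⟨i, _ | _⟩ <;> simp [letterVal, letterInv]

/-- A history is a list of triples `(a, u, v)`, recording that the letter `a` sends `u` to `v`. -/
abbrev History (ι V : Type*) := List ((ι × Bool) × V × V)

variable (F) in
/-- The subspace on which a history determines the letter `e`. -/
def knownDomain [DecidableEq ι] (e : ι × Bool) : History ι V → Submodule F V
  | [] => ⊥
  | (a, v, v') :: L =>
    knownDomain e L ⊔ if e = a then F ∙ v else if e = letterInv a then F ∙ v' else ⊥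

/-- The span of `U` and of all the vectors reached in a history. -/
def reached (U : Submodule F V) : History ι V → Submodule F V
  | [] => U
  | (_, _, v') :: L => reached U L ⊔ F ∙ v'

/-- The tuple `x` acts as recorded in the history. -/
def Consistent (ρ : Representation F G V) (x : ι → G) (L : History ι V) : Prop :=
  ∀ t ∈ L, ρ (letterVal x t.1) t.2.1 = t.2.2

lemma consistent_cons {ρ : Representation F G V} {x : ι → G} {L : History ι V} {a : ι × Bool}
    {v v' : V} : Consistent ρ x ((a, v, v') :: L) ↔
      Consistent ρ x L ∧ ρ (letterVal x a) v = v' := by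
  simp [Consistent, and_comm]

/-- The history extended by the trajectory of `v` under the successive letters of a word. -/
def runWord (ρ : Representation F G V) (x : ι → G) :
    History ι V → V → List (ι × Bool) → History ι V
  | L, _, [] => L
  | L, v, a :: ls => runWord ρ x ((a, v, ρ (letterVal x a) v) :: L) (ρ (letterVal x a) v) ls

/-- The history extended by the trajectories of several vectors under a word. -/
def runWords (ρ : Representation F G V) (x : ι → G) (ls : List (ι × Bool)) :
    History ι V → List V → History ι V
  | L, [] => L
  | L, u :: us => runWords ρ x ls (runWord ρ x L u ls) us

/-- The endpoint of the trajectory of a vector under a word. -/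
lemma inv_lift_mk_cons (ρ : Representation F G V) (x : ι → G) (a : ι × Bool)
    (ls : List (ι × Bool)) (v : V) :
    ρ (FreeGroup.lift x (FreeGroup.mk (a :: ls)))⁻¹ v =
      ρ (FreeGroup.lift x (FreeGroup.mk ls))⁻¹ (ρ (letterVal x a) v) := by
  rcases a with ⟨i, _ | _⟩ <;> simp [letterVal, FreeGroup.lift_mk]

lemma finrank_span_singleton_le (v : V) : finrank F (F ∙ v) ≤ 1 :=
  (finrank_span_le_card {v}).trans (by simp)

/-- The pointwise stabilizer of every subspace of dimension at most `M` is transitive on the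
complement of the subspace. -/
def TransitiveOffSubspaces (ρ : Representation F G V) (M : ℕ) : Prop :=
  ∀ R : Submodule F V, finrank F R ≤ M → ∀ v ∉ R, ∀ v' ∉ R,
    ∃ g, (∀ y ∈ R, ρ g y = y) ∧ ρ g v = v'

lemma finrank_reached_le [FiniteDimensional F V] (U : Submodule F V) (L : History ι V) :
    finrank F (reached U L) ≤ finrank F U + L.length := by
  induction L with
  | nil => exact Nat.le_add_right _ _
  | cons t L ih =>
    have h1 := finrank_add_le_finrank_add_finrank (reached U L) (F ∙ t.2.2)
    have h2 : finrank F (F ∙ t.2.2) ≤ 1 := finrank_span_singleton_le _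
    change finrank F ↥(reached U L ⊔ F ∙ t.2.2) ≤ finrank F U + (L.length + 1)
    omega

/-- The properties of the parameters that make the average weight at most double with each query:
`p` bounds the probability that an undetermined image lies in a given space of dimension `M`. -/
structure WeightParams [Fintype F] (ρ : Representation F G V) (M : ℕ) (p y : ℝ) : Prop where
  transitive : TransitiveOffSubspaces ρ M
  lt_finrank : M < finrank F V
  p_pos : 0 < p
  one_le_y : 1 ≤ y
  mul_sq : p * y ^ 2 = 1
  card_pow : (Fintype.card F : ℝ) ^ M =
    p * ((Fintype.card F : ℝ) ^ finrank F V - (Fintype.card F : ℝ) ^ M)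

lemma le_reached (U : Submodule F V) (L : History ι V) : U ≤ reached U L := by
  induction L with
  | nil => exact le_rfl
  | cons t L ih => exact ih.trans le_sup_left

variable [DecidableEq ι]

lemma knownDomain_cons_self (e : ι × Bool) (v v' : V) (L : History ι V) :
    v ∈ knownDomain F e ((e, v, v') :: L) := by
  simpa [knownDomain] using mem_sup_right (mem_span_singleton_self v)

lemma knownDomain_cons_letterInv (e : ι × Bool) (v v' : V) (L : History ι V) :
    v' ∈ knownDomain F (letterInv e) ((e, v, v') :: L) := by
  simpa [knownDomain, letterInv_ne] using mem_sup_right (mem_span_singleton_self v')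

lemma knownDomain_le_cons (e : ι × Bool) (t) (L : History ι V) :
    knownDomain F e L ≤ knownDomain F e (t :: L) := le_sup_left

lemma knownDomain_le_runWord (ρ : Representation F G V) (x : ι → G) (e : ι × Bool)
    (L : History ι V) (v : V) (ls : List (ι × Bool)) :
    knownDomain F e L ≤ knownDomain F e (runWord ρ x L v ls) := by
  induction ls generalizing L v with
  | nil => exact le_rfl
  | cons a ls ih => exact (knownDomain_le_cons e _ L).trans (ih _ _)

lemma knownDomain_le_runWords (ρ : Representation F G V) (x : ι → G) (ls : List (ι × Bool))
    (e : ι × Bool) (L : History ι V) (us : List V) :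
    knownDomain F e L ≤ knownDomain F e (runWords ρ x ls L us) := by
  induction us generalizing L with
  | nil => exact le_rfl
  | cons u us ih => exact (knownDomain_le_runWord ρ x e L u ls).trans (ih _)

lemma mem_knownDomain_of_consistent {ρ : Representation F G V} {x : ι → G} {L : History ι V}
    (hx : Consistent ρ x L) {e : ι × Bool} {v : V} (hv : v ∈ knownDomain F e L) :
    ρ (letterVal x e) v ∈ knownDomain F (letterInv e) L := by
  suffices knownDomain F e L ≤ (knownDomain F (letterInv e) L).comap (ρ (letterVal x e)) from
    this hv
  clear hv
  induction L with
  | nil => simp [knownDomain]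
  | cons t L ih =>
    obtain ⟨a, v, v'⟩ := t
    obtain ⟨hL, hv⟩ := consistent_cons.1 hx
    refine sup_le ((ih hL).trans (comap_mono (knownDomain_le_cons _ _ _))) ?_
    split_ifs with h1 h2
    · subst h1
      rw [span_singleton_le_iff_mem, mem_comap, hv]
      exact knownDomain_cons_letterInv _ _ _ _
    · subst h2
      rw [span_singleton_le_iff_mem, mem_comap, letterVal_letterInv, letterInv_letterInv, ← hv,
        Representation.inv_self_apply]
      exact knownDomain_cons_self _ _ _ _
    · exact bot_le

variable (F) in
/-- The span of the vectors on which a history determines two different letters. -/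
def doublyKnown (L : History ι V) : Submodule F V :=
  span F {y | ∃ a b, a ≠ b ∧ y ∈ knownDomain F a L ∧ y ∈ knownDomain F b L}

lemma doublyKnown_mono {L L' : History ι V} (h : ∀ e, knownDomain F e L ≤ knownDomain F e L') :
    doublyKnown F L ≤ doublyKnown F L' :=
  span_mono fun _ ⟨a, b, hab, ha, hb⟩ => ⟨a, b, hab, h a ha, h b hb⟩

lemma reached_runWord_le (ρ : Representation F G V) (x : ι → G) {U : Submodule F V}
    (L : History ι V) (v : V) (ls : List (ι × Bool)) (hls : FreeGroup.IsReduced ls)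
    (hend : ls ≠ [] → ρ (FreeGroup.lift x (FreeGroup.mk ls))⁻¹ v ∈ U) :
    reached U (runWord ρ x L v ls) ≤ reached U L ⊔ (U ⊔ doublyKnown F (runWord ρ x L v ls)) := by
  induction ls generalizing L v with
  | nil => exact le_sup_left
  | cons a ls ih =>
    refine (ih _ _ (List.IsChain.tail hls) fun _ => ?_).trans
      (sup_le (sup_le le_sup_left (le_sup_of_le_right ?_)) le_sup_right)
    · exact inv_lift_mk_cons ρ x a ls v ▸ hend (by simp)
    · rw [span_singleton_le_iff_mem]
      rcases ls with _ | ⟨b, ls⟩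
      · have h := hend (by simp)
        rw [inv_lift_mk_cons] at h
        exact mem_sup_left (by simpa using h)
      · refine mem_sup_right (subset_span ⟨letterInv a, b, ?_, ?_, ?_⟩)
        · have h := (List.isChain_cons_cons.1 hls).1
          rintro rfl
          simp [letterInv] at h
        · rw [runWord]
          exact knownDomain_le_runWord _ _ _ _ _ _ (knownDomain_cons_letterInv _ _ _ _)
        · rw [runWord, runWord]
          exact knownDomain_le_runWord _ _ _ _ _ _ (knownDomain_cons_self _ _ _ _)

lemma mem_knownDomain_head_runWord (ρ : Representation F G V) (x : ι → G) (L : History ι V) (v : V)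
    (a : ι × Bool) (ls : List (ι × Bool)) :
    v ∈ knownDomain F a (runWord ρ x L v (a :: ls)) := by
  rw [runWord]
  exact knownDomain_le_runWord _ _ _ _ _ _ (knownDomain_cons_self _ _ _ _)

lemma mem_knownDomain_last_runWord (ρ : Representation F G V) (x : ι → G) (L : History ι V) (v : V)
    (a : ι × Bool) (ls : List (ι × Bool)) (ha : a ∈ ls.getLast?) :
    ρ (FreeGroup.lift x (FreeGroup.mk ls))⁻¹ v ∈
      knownDomain F (letterInv a) (runWord ρ x L v ls) := by
  induction ls generalizing L v with
  | nil => simp at ha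
  | cons b ls ih =>
    rw [inv_lift_mk_cons]
    rcases ls with _ | ⟨c, ls⟩
    · obtain rfl : b = a := by simpa using ha
      simpa [runWord] using knownDomain_cons_letterInv _ _ _ _
    · exact ih _ _ (by simpa using ha)

lemma reached_runWords_le (ρ : Representation F G V) (x : ι → G) {U : Submodule F V}
    {ls : List (ι × Bool)} (hls : FreeGroup.IsReduced ls) (L : History ι V) (us : List V)
    (hend : ∀ u ∈ us, ρ (FreeGroup.lift x (FreeGroup.mk ls))⁻¹ u ∈ U) :
    reached U (runWords ρ x ls L us) ≤
      reached U L ⊔ (U ⊔ doublyKnown F (runWords ρ x ls L us)) := by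
  induction us generalizing L with
  | nil => exact le_sup_left
  | cons u us ih =>
    refine (ih _ fun u' hu' => hend u' (List.mem_cons_of_mem _ hu')).trans
      (sup_le ?_ le_sup_right)
    refine (reached_runWord_le ρ x L u ls hls fun _ => hend u List.mem_cons_self).trans ?_
    exact sup_le_sup_left (sup_le_sup_left
      (doublyKnown_mono fun e => knownDomain_le_runWords _ _ _ _ _ _) _) _

lemma knownDomain_runWords_of_mem (ρ : Representation F G V) (x : ι → G) (ls : List (ι × Bool))
    (L : History ι V) (us : List V) (e : ι × Bool) (φ : V → V)
    (h : ∀ L u, φ u ∈ knownDomain F e (runWord ρ x L u ls)) :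
    ∀ u ∈ us, φ u ∈ knownDomain F e (runWords ρ x ls L us) := by
  induction us generalizing L with
  | nil => simp
  | cons u us ih =>
    intro u' hu'
    rcases List.mem_cons.1 hu' with rfl | hu'
    · rw [runWords]
      exact knownDomain_le_runWords _ _ _ _ _ _ (h _ _)
    · exact ih _ u' hu'

/-- If the image of a cyclically reduced word stabilizes `U`, then every reached vector is a
combination of vectors on which two letters are determined. -/
lemma reached_le_doublyKnown (ρ : Representation F G V) (x : ι → G) {U : Submodule F V}
    {ls : List (ι × Bool)} (hls : FreeGroup.IsCyclicallyReduced ls) (hne : ls ≠ [])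
    {us : List V} (hus : span F {u | u ∈ us} = U)
    (hU : U.map (ρ (FreeGroup.lift x (FreeGroup.mk ls))⁻¹) = U) :
    reached U (runWords ρ x ls [] us) ≤ doublyKnown F (runWords ρ x ls [] us) := by
  have hend : ∀ u ∈ us, ρ (FreeGroup.lift x (FreeGroup.mk ls))⁻¹ u ∈ U := fun u hu => by
    rw [← hU]
    exact mem_map_of_mem (hus ▸ subset_span hu)
  refine (reached_runWords_le ρ x hls.1 [] us hend).trans ?_
  suffices U ≤ doublyKnown F (runWords ρ x ls [] us) from sup_le this (sup_le this le_rfl)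
  obtain ⟨a, ls', rfl⟩ := List.exists_cons_of_ne_nil hne
  have hb := List.getLast?_eq_getLast_of_ne_nil hne
  set b := (a :: ls').getLast hne
  have h1 : U ≤ knownDomain F a (runWords ρ x (a :: ls') [] us) := by
    rw [← hus, span_le]
    exact knownDomain_runWords_of_mem ρ x _ _ _ _ id
      fun L u => mem_knownDomain_head_runWord _ _ _ _ _ _
  have h2 : U ≤ knownDomain F (letterInv b) (runWords ρ x (a :: ls') [] us) := by
    rw [← hU]
    nth_rw 1 [← hus]
    rw [map_span, span_le]
    rintro _ ⟨u, hu, rfl⟩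
    exact knownDomain_runWords_of_mem ρ x _ _ _ _ _
      (fun L u => mem_knownDomain_last_runWord _ _ _ _ _ _ hb) u hu
  refine fun y hy => subset_span ⟨a, letterInv b, ?_, h1 hy, h2 hy⟩
  have h := hls.2 b hb a (by simp)
  rintro h'
  rw [h'] at h
  simp [letterInv] at h

lemma two_mul_finrank_le_of_le_doublyKnown [Fintype ι] [FiniteDimensional F V]
    {L : History ι V} {W : Submodule F V} (hW : W ≤ doublyKnown F L) :
    2 * finrank F W ≤ ∑ e, finrank F (knownDomain F e L) := by
  classical
  refine (Nat.mul_le_mul_left 2 (finrank_mono hW)).trans ?_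
  obtain ⟨B, hB, hspan, hind⟩ := exists_linearIndependent F
    {y | ∃ a b, a ≠ b ∧ y ∈ knownDomain F a L ∧ y ∈ knownDomain F b L}
  have : Fintype B := (hind.setFinite).fintype
  have hcard : finrank F (doublyKnown F L) = Fintype.card B := by
    rw [doublyKnown, ← hspan, finrank_span_set_eq_card hind, Set.toFinset_card]
  have hle (e : ι × Bool) :
      (Finset.univ.filter fun y : B => (y : V) ∈ knownDomain F e L).card ≤
        finrank F (knownDomain F e L) := by
    rw [← Fintype.card_subtype]
    refine LinearIndependent.fintype_card_le_finrank (R := F)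
      (b := fun y : {y : B // (y : V) ∈ knownDomain F e L} => (⟨y.1, y.2⟩ : knownDomain F e L)) ?_
    refine LinearIndependent.of_comp (knownDomain F e L).subtype ?_
    exact hind.comp _ Subtype.val_injective
  refine le_trans ?_ (Finset.sum_le_sum fun e _ => hle e)
  simp_rw [Finset.card_filter]
  rw [Finset.sum_comm, hcard, mul_comm, ← smul_eq_mul, Fintype.card, ← Finset.sum_const]
  refine Finset.sum_le_sum fun y _ => ?_
  obtain ⟨a, b, hab, ha, hb⟩ := hB y.2
  rw [← Finset.card_filter, Nat.succ_le_iff, Finset.one_lt_card]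
  exact ⟨a, by simpa using ha, b, by simpa using hb, hab⟩

/-- Multiply the image of the letter `a` by `g` from the left. -/
def twistTuple (a : ι × Bool) (g : G) (x : ι → G) : ι → G :=
  Function.update x a.1 (cond a.2 (x a.1 * g⁻¹) (g * x a.1))

lemma letterVal_twistTuple (a : ι × Bool) (g : G) (x : ι → G) :
    letterVal (twistTuple a g x) a = g * letterVal x a := by
  rcases a with ⟨i, _ | _⟩ <;> simp [letterVal, twistTuple]

lemma letterVal_twistTuple_of_ne (a b : ι × Bool) (g : G) (x : ι → G) (hba : b ≠ a)
    (hba' : b ≠ letterInv a) : letterVal (twistTuple a g x) b = letterVal x b := by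
  have h : b.1 ≠ a.1 := by
    rcases a with ⟨i, _ | _⟩ <;> rcases b with ⟨j, _ | _⟩ <;> simp_all [letterInv]
  simp [letterVal, twistTuple, h]

lemma twistTuple_injective (a : ι × Bool) (g : G) :
    Function.Injective (twistTuple (ι := ι) a g) := by
  intro x x' h
  funext i
  have hi := congrFun h i
  by_cases hia : i = a.1
  · subst hia
    rcases a with ⟨i, _ | _⟩ <;> simpa [twistTuple] using hi
  · simpa [twistTuple, hia] using hi

lemma mem_knownDomain_of_mem {L : History ι V} {a : ι × Bool} {v v' : V} (h : (a, v, v') ∈ L) :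
    v ∈ knownDomain F a L ∧ v' ∈ knownDomain F (letterInv a) L := by
  induction L with
  | nil => simp at h
  | cons t L ih =>
    rcases List.mem_cons.1 h with rfl | h
    · exact ⟨knownDomain_cons_self _ _ _ _, knownDomain_cons_letterInv _ _ _ _⟩
    · exact ⟨knownDomain_le_cons _ _ _ (ih h).1, knownDomain_le_cons _ _ _ (ih h).2⟩

lemma Consistent.twistTuple {ρ : Representation F G V} {x : ι → G} {L : History ι V}
    (hx : Consistent ρ x L) {a : ι × Bool} {g : G}
    (hg : ∀ y ∈ knownDomain F (letterInv a) L, ρ g y = y) :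
    Consistent ρ (twistTuple a g x) L := by
  rintro ⟨b, v, v'⟩ hb
  have hval : ρ (letterVal x b) v = v' := hx _ hb
  have hmem := mem_knownDomain_of_mem (F := F) hb
  by_cases hba : b = a
  · subst hba
    simp [letterVal_twistTuple, hval, hg _ hmem.2]
  by_cases hba' : b = letterInv a
  · subst hba'
    have hgv : ρ g⁻¹ v = v := by
      conv_lhs => rw [← hg v hmem.1, Representation.inv_self_apply]
    rw [letterVal_letterInv] at hval
    simp [letterVal_letterInv, letterVal_twistTuple, hgv, hval]
  · simpa [letterVal_twistTuple_of_ne a b g x hba hba'] using hval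

lemma knownDomain_cons_le_reached {U : Submodule F V} {L : History ι V}
    (hL : ∀ e, knownDomain F e L ≤ reached U L) (a : ι × Bool) {v : V} (hv : v ∈ reached U L)
    (v' : V) (e : ι × Bool) :
    knownDomain F e ((a, v, v') :: L) ≤ reached U ((a, v, v') :: L) := by
  refine sup_le ((hL e).trans le_sup_left) ?_
  split_ifs
  · exact (span_singleton_le_iff_mem _ _).2 (mem_sup_left hv)
  · exact le_sup_right
  · exact bot_le

end Histories

section Counting

open Classical in
/-- The tuples which act as recorded in a history. -/
noncomputable def consistentTuples {F V G ι : Type*} [Field F] [AddCommGroup V] [Module F V]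
    [Group G] [Fintype ι] [Fintype G] (ρ : Representation F G V) (L : History ι V) :
    Finset (ι → G) :=
  Finset.univ.filter fun x => Consistent ρ x L

variable {F V G ι : Type*} [Field F] [AddCommGroup V] [Module F V] [Group G]
  [Fintype ι] [Fintype G]

@[simp] lemma mem_consistentTuples {ρ : Representation F G V} {L : History ι V} {x : ι → G} :
    x ∈ consistentTuples ρ L ↔ Consistent ρ x L := by
  simp [consistentTuples]

lemma filter_consistentTuples [DecidableEq V] (ρ : Representation F G V) (L : History ι V)
    (a : ι × Bool) (v v' : V) :
    (consistentTuples ρ L).filter (fun x => ρ (letterVal x a) v = v') =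
      consistentTuples ρ ((a, v, v') :: L) := by
  ext x
  simp [consistent_cons]

variable [DecidableEq ι]

lemma card_fiber_le [DecidableEq V] {ρ : Representation F G V} {M : ℕ}
    (hρ : TransitiveOffSubspaces ρ M) (L : History ι V) (a : ι × Bool) (v : V)
    (hM : finrank F (knownDomain F (letterInv a) L) ≤ M) {v' v'' : V}
    (hv' : v' ∉ knownDomain F (letterInv a) L) (hv'' : v'' ∉ knownDomain F (letterInv a) L) :
    ((consistentTuples ρ L).filter fun x => ρ (letterVal x a) v = v').card ≤
      ((consistentTuples ρ L).filter fun x => ρ (letterVal x a) v = v'').card := by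
  obtain ⟨g, hg, hgv⟩ := hρ _ hM v' hv' v'' hv''
  refine Finset.card_le_card_of_injOn (twistTuple a g) (fun x hx => ?_)
    (twistTuple_injective a g).injOn
  simp only [Finset.coe_filter, mem_consistentTuples, Set.mem_ofPred_eq] at hx ⊢
  refine ⟨hx.1.twistTuple hg, ?_⟩
  simp [letterVal_twistTuple, hx.2, hgv]

open Classical in
/-- If the image of `v` under the letter `a` is not determined, then it rarely lies in `S`. -/
lemma card_hit_mul_le [Fintype V] {ρ : Representation F G V} {M : ℕ}
    (hρ : TransitiveOffSubspaces ρ M) (L : History ι V) (a : ι × Bool) (v : V)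
    (hM : finrank F (knownDomain F (letterInv a) L) ≤ M) (hv : v ∉ knownDomain F a L)
    (S : Submodule F V) :
    ((consistentTuples ρ L).filter fun x => ρ (letterVal x a) v ∈ S).card *
        (Finset.univ.filter fun v' => v' ∉ knownDomain F (letterInv a) L).card ≤
      Fintype.card S * (consistentTuples ρ L).card := by
  set R := knownDomain F (letterInv a) L
  set N : V → ℕ := fun v' =>
    ((consistentTuples ρ L).filter fun x => ρ (letterVal x a) v = v').card with hN
  have hfib (t : Finset V) : ∑ v' ∈ t, N v' =
      ((consistentTuples ρ L).filter fun x => ρ (letterVal x a) v ∈ t).card :=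
    Finset.sum_card_fiberwise_eq_card_filter _ t fun x => ρ (letterVal x a) v
  have hT : ((consistentTuples ρ L).filter fun x => ρ (letterVal x a) v ∈ S).card =
      ∑ v' with v' ∈ S, N v' := by
    simp [hfib]
  have hR : ∀ v' ∈ R, N v' = 0 := fun v' hv' => by
    rw [hN, Finset.card_eq_zero, Finset.filter_eq_empty_iff]
    rintro x hx rfl
    have := mem_knownDomain_of_consistent (mem_consistentTuples.1 hx) hv'
    rw [letterVal_letterInv, letterInv_letterInv, Representation.inv_self_apply] at this
    exact hv this
  rw [hT, Finset.sum_mul, Fintype.card_subtype, ← smul_eq_mul, ← Finset.sum_const]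
  refine Finset.sum_le_sum fun v' _ => ?_
  by_cases hv' : v' ∈ R
  · simp [hR v' hv']
  calc _ = ∑ v'' with v'' ∉ R, N v' := by simp [mul_comm]
    _ ≤ ∑ v'' with v'' ∉ R, N v'' := Finset.sum_le_sum fun v'' hv'' =>
        card_fiber_le hρ L a v hM hv' (by simpa using hv'')
    _ ≤ _ := by
        rw [hfib]
        exact Finset.card_filter_le _ _

/-- The weight of a history: passing to a new independent vector leaves it unchanged, and reaching
a vector in the span of the old ones multiplies it by `y ^ 2`. -/
noncomputable def historyWeight (p y : ℝ) (U : Submodule F V) (L : History ι V) : ℝ :=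
  p ^ finrank F (reached U L) * y ^ ∑ e, finrank F (knownDomain F e L)

lemma sum_finrank_knownDomain_cons_le [FiniteDimensional F V] (a : ι × Bool) (v v' : V)
    (L : History ι V) :
    ∑ e, finrank F (knownDomain F e ((a, v, v') :: L)) ≤
      ∑ e, finrank F (knownDomain F e L) + 2 := by
  have h (e : ι × Bool) : finrank F (knownDomain F e ((a, v, v') :: L)) ≤
      finrank F (knownDomain F e L) +
        ((if e = a then 1 else 0) + if e = letterInv a then 1 else 0) := by
    refine (finrank_add_le_finrank_add_finrank _ _).trans (Nat.add_le_add_left ?_ _)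
    have hv := finrank_span_singleton_le (F := F) v
    have hv' := finrank_span_singleton_le (F := F) v'
    by_cases h1 : e = a
    · rw [if_pos h1, if_pos h1]
      exact hv.trans (Nat.le_add_right _ _)
    by_cases h2 : e = letterInv a
    · rw [if_neg h1, if_pos h2, if_neg h1, if_pos h2]
      exact hv'
    · rw [if_neg h1, if_neg h2, finrank_bot]
      exact Nat.zero_le _
  refine (Finset.sum_le_sum fun e _ => h e).trans ?_
  simp [Finset.sum_add_distrib]

open Classical in
/-- One query at most doubles the average weight. -/
lemma sum_historyWeight_cons_le [Fintype F] [Fintype V] {ρ : Representation F G V} {M : ℕ}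
    {p y : ℝ} (hρ : WeightParams ρ M p y) {U : Submodule F V} {L : History ι V}
    (hL : ∀ e, knownDomain F e L ≤ reached U L) (hM : finrank F (reached U L) ≤ M) (a : ι × Bool) (v : V) :
    ∑ x ∈ consistentTuples ρ L, historyWeight p y U ((a, v, ρ (letterVal x a) v) :: L) ≤
      2 * (historyWeight p y U L * (consistentTuples ρ L).card) := by
  obtain ⟨htrans, hMn, hp, hy, hpy, hpM⟩ := hρ
  have hw0 : 0 ≤ historyWeight p y U L := by unfold historyWeight; positivity
  by_cases hva : v ∈ knownDomain F a L
  · have h : ∀ x ∈ consistentTuples ρ L,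
        historyWeight p y U ((a, v, ρ (letterVal x a) v) :: L) = historyWeight p y U L := by
      intro x hx
      have hmem := mem_knownDomain_of_consistent (mem_consistentTuples.1 hx) hva
      have h1 : reached U ((a, v, ρ (letterVal x a) v) :: L) = reached U L := by
        simpa [reached] using hL _ hmem
      have h2 (e) : knownDomain F e ((a, v, ρ (letterVal x a) v) :: L) = knownDomain F e L := by
        rw [knownDomain, sup_eq_left]
        split_ifs with h h'
        · simpa [h] using hva
        · simpa [h'] using hmem
        · exact bot_le
      rw [historyWeight, historyWeight, h1, Finset.sum_congr rfl fun e _ => by rw [h2 e]]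
    rw [Finset.sum_congr rfl h, Finset.sum_const, nsmul_eq_mul]
    nlinarith [mul_nonneg hw0 (Nat.cast_nonneg (α := ℝ) (consistentTuples ρ L).card)]
  · have h : ∀ x ∈ consistentTuples ρ L,
        historyWeight p y U ((a, v, ρ (letterVal x a) v) :: L) ≤
          historyWeight p y U L +
            if ρ (letterVal x a) v ∈ reached U L then y ^ 2 * historyWeight p y U L else 0 := by
      intro x _
      have hpow : y ^ (∑ e, finrank F (knownDomain F e ((a, v, ρ (letterVal x a) v) :: L))) ≤
          y ^ (∑ e, finrank F (knownDomain F e L)) * y ^ 2 := by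
        rw [← pow_add]
        exact pow_le_pow_right₀ hy (sum_finrank_knownDomain_cons_le _ _ _ _)
      split_ifs with hmem
      · have h1 : reached U ((a, v, ρ (letterVal x a) v) :: L) = reached U L := by
          simpa [reached] using hmem
        refine le_trans ?_ (le_add_of_nonneg_left hw0)
        rw [historyWeight, h1, historyWeight]
        calc _ ≤ p ^ finrank F (reached U L) * (_ * y ^ 2) :=
              mul_le_mul_of_nonneg_left hpow (by positivity)
          _ = _ := by ring
      · have h1 : finrank F (reached U ((a, v, ρ (letterVal x a) v) :: L)) =
            finrank F (reached U L) + 1 := by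
          refine le_antisymm ?_ (Submodule.finrank_lt_finrank_of_lt ?_)
          · exact (finrank_add_le_finrank_add_finrank _ _).trans
              (Nat.add_le_add_left (finrank_span_singleton_le _) _)
          · simpa [reached] using hmem
        rw [add_zero, historyWeight, h1, historyWeight]
        calc _ ≤ p ^ (finrank F (reached U L) + 1) * (_ * y ^ 2) :=
              mul_le_mul_of_nonneg_left hpow (by positivity)
          _ = p ^ finrank F (reached U L) * y ^ (∑ e, finrank F (knownDomain F e L)) *
                (p * y ^ 2) := by ring
          _ = _ := by rw [hpy, mul_one]
    refine (Finset.sum_le_sum h).trans ?_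
    rw [Finset.sum_add_distrib, ← Finset.sum_filter, Finset.sum_const, Finset.sum_const,
      nsmul_eq_mul, nsmul_eq_mul]
    set T := ((consistentTuples ρ L).filter fun x => ρ (letterVal x a) v ∈ reached U L).card
    set C := (consistentTuples ρ L).card
    suffices hT : (T : ℝ) ≤ p * C by
      have : (T : ℝ) * y ^ 2 ≤ C := by
        calc (T : ℝ) * y ^ 2 ≤ p * C * y ^ 2 := by gcongr
          _ = C * (p * y ^ 2) := by ring
          _ = C := by rw [hpy, mul_one]
      nlinarith
    have hq : (1 : ℝ) < Fintype.card F := by exact_mod_cast Fintype.one_lt_card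
    have hpos : 0 < (Fintype.card F : ℝ) ^ finrank F V - (Fintype.card F : ℝ) ^ M :=
      sub_pos.2 (pow_lt_pow_right₀ hq hMn)
    have hRM : finrank F (knownDomain F (letterInv a) L) ≤ M :=
      (finrank_mono (hL _)).trans hM
    have key := card_hit_mul_le htrans L a v hRM hva (reached U L)
    have hS : (Fintype.card (reached U L) : ℝ) ≤ (Fintype.card F : ℝ) ^ M := by
      rw [Module.card_eq_pow_finrank (K := F) (V := reached U L)]
      exact_mod_cast Nat.pow_le_pow_right Fintype.card_pos hM
    have hR : (Fintype.card F : ℝ) ^ finrank F V - (Fintype.card F : ℝ) ^ M ≤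
        (Finset.univ.filter fun v' => v' ∉ knownDomain F (letterInv a) L).card := by
      have h1 := Finset.card_filter_add_card_filter_not (s := (Finset.univ : Finset V))
        (fun v' => v' ∈ knownDomain F (letterInv a) L)
      rw [← Fintype.card_subtype, Finset.card_univ, Module.card_eq_pow_finrank (K := F) (V := V),
        Module.card_eq_pow_finrank (K := F) (V := {x // x ∈ knownDomain F (letterInv a) L})] at h1
      have h2 : Fintype.card F ^ finrank F (knownDomain F (letterInv a) L) ≤
          Fintype.card F ^ M := Nat.pow_le_pow_right Fintype.card_pos hRM
      rw [sub_le_iff_le_add']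
      exact_mod_cast h1.symm.le.trans (Nat.add_le_add_right h2 _)
    refine le_of_mul_le_mul_right ?_ hpos
    calc (T : ℝ) * _ ≤ T * _ := mul_le_mul_of_nonneg_left hR (Nat.cast_nonneg _)
      _ ≤ Fintype.card (reached U L) * C := by
          rw [← Nat.cast_mul, ← Nat.cast_mul]
          exact Nat.cast_le.2 key
      _ ≤ (Fintype.card F : ℝ) ^ M * C := mul_le_mul_of_nonneg_right hS (Nat.cast_nonneg _)
      _ = p * C * ((Fintype.card F : ℝ) ^ finrank F V - (Fintype.card F : ℝ) ^ M) := by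
          linear_combination (C : ℝ) * hpM

section Run

variable [Fintype F] [Fintype V] {ρ : Representation F G V} {M : ℕ} {p y : ℝ} {U : Submodule F V}

open Classical in
lemma sum_runWord_le (hρ : WeightParams ρ M p y)
    {Φ : History ι V → (ι → G) → ℝ} {K : ℝ} (hK : 0 ≤ K) {m : ℕ}
    (hm : finrank F U + m ≤ M + 1)
    (hΦ : ∀ L : History ι V, (∀ e, knownDomain F e L ≤ reached U L) → L.length = m →
      ∑ x ∈ consistentTuples ρ L, Φ L x ≤
        K * (historyWeight p y U L * (consistentTuples ρ L).card))
    (ls : List (ι × Bool)) (L : History ι V) (v : V)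
    (hL : ∀ e, knownDomain F e L ≤ reached U L) (hv : v ∈ reached U L)
    (hlen : L.length + ls.length = m) :
    ∑ x ∈ consistentTuples ρ L, Φ (runWord ρ x L v ls) x ≤
      2 ^ ls.length * K * (historyWeight p y U L * (consistentTuples ρ L).card) := by
  induction ls generalizing L v with
  | nil => simpa [runWord] using hΦ L hL (by simpa using hlen)
  | cons a ls ih =>
    rw [List.length_cons] at hlen
    have hM : finrank F (reached U L) ≤ M := by
      have := finrank_reached_le U L
      omega
    calc ∑ x ∈ consistentTuples ρ L, Φ (runWord ρ x L v (a :: ls)) x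
        = ∑ v', ∑ x ∈ consistentTuples ρ L with ρ (letterVal x a) v = v',
            Φ (runWord ρ x L v (a :: ls)) x :=
          (Finset.sum_fiberwise _ (fun x => ρ (letterVal x a) v) _).symm
      _ = ∑ v', ∑ x ∈ consistentTuples ρ ((a, v, v') :: L),
            Φ (runWord ρ x ((a, v, v') :: L) v' ls) x := by
          refine Finset.sum_congr rfl fun v' _ => ?_
          rw [← filter_consistentTuples]
          refine Finset.sum_congr rfl fun x hx => ?_
          rw [runWord, (Finset.mem_filter.1 hx).2]
      _ ≤ ∑ v', 2 ^ ls.length * K * (historyWeight p y U ((a, v, v') :: L) *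
            (consistentTuples ρ ((a, v, v') :: L)).card) :=
          Finset.sum_le_sum fun v' _ => ih _ _ (knownDomain_cons_le_reached hL a hv v')
            (mem_sup_right (mem_span_singleton_self v')) (by rw [List.length_cons]; omega)
      _ = 2 ^ ls.length * K * ∑ v', ∑ x ∈ consistentTuples ρ L with ρ (letterVal x a) v = v',
            historyWeight p y U ((a, v, ρ (letterVal x a) v) :: L) := by
          rw [Finset.mul_sum]
          refine Finset.sum_congr rfl fun v' _ => ?_
          rw [← filter_consistentTuples, Finset.sum_congr rfl fun x hx => by
            rw [(Finset.mem_filter.1 hx).2], Finset.sum_const, nsmul_eq_mul]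
          ring
      _ = 2 ^ ls.length * K * ∑ x ∈ consistentTuples ρ L,
            historyWeight p y U ((a, v, ρ (letterVal x a) v) :: L) := by
          rw [Finset.sum_fiberwise _ (fun x => ρ (letterVal x a) v)]
      _ ≤ 2 ^ ls.length * K * (2 * (historyWeight p y U L * (consistentTuples ρ L).card)) :=
          mul_le_mul_of_nonneg_left
            (sum_historyWeight_cons_le hρ hL hM a v) (by positivity)
      _ = _ := by rw [List.length_cons]; ring

lemma sum_runWords_le (hρ : WeightParams ρ M p y) (ls : List (ι × Bool)) (us : List V)
    (hus : ∀ u ∈ us, u ∈ U)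
    (L : History ι V) (hL : ∀ e, knownDomain F e L ≤ reached U L)
    (hlen : finrank F U + (L.length + us.length * ls.length) ≤ M + 1) :
    ∑ x ∈ consistentTuples ρ L, historyWeight p y U (runWords ρ x ls L us) ≤
      2 ^ (us.length * ls.length) * (historyWeight p y U L * (consistentTuples ρ L).card) := by
  induction us generalizing L with
  | nil => simp [runWords, mul_comm]
  | cons u us ih =>
    rw [List.length_cons, Nat.succ_mul] at hlen
    have h := sum_runWord_le hρ (Φ := fun L x => historyWeight p y U (runWords ρ x ls L us))
      (K := 2 ^ (us.length * ls.length)) (by positivity) (m := L.length + ls.length) (by omega)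
      (fun L' hL' hlen' => ih (fun u' hu' => hus u' (List.mem_cons_of_mem _ hu')) L' hL'
        (by omega)) ls L u hL (le_reached U L (hus u List.mem_cons_self)) rfl
    refine h.trans_eq ?_
    rw [List.length_cons, Nat.succ_mul]
    ring

open Classical in
/-- The number of tuples at which a cyclically reduced word stabilizes `U`. -/
lemma card_stabilizing_le (hρ : WeightParams ρ M p y) {ls : List (ι × Bool)}
    (hls : FreeGroup.IsCyclicallyReduced ls) (hne : ls ≠ [])
    (hM : finrank F U + finrank F U * ls.length ≤ M + 1) :
    ((Finset.univ.filter fun x : ι → G =>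
        U.map (ρ (FreeGroup.lift x (FreeGroup.mk ls))⁻¹) = U).card : ℝ) ≤
      (2 ^ ls.length * p) ^ finrank F U * Fintype.card (ι → G) := by
  set us : List V := List.ofFn fun i => (finBasis F U i : V) with hus
  have hlen : us.length = finrank F U := by simp [hus]
  have hspan : span F {u | u ∈ us} = U := by
    have h : {u | u ∈ us} = U.subtype '' Set.range (finBasis F U) := by
      ext u
      simp [hus, List.mem_ofFn]
    rw [h, ← map_span, (finBasis F U).span_eq, Submodule.map_top, range_subtype]
  have hmem : ∀ u ∈ us, u ∈ U := fun u hu => hspan ▸ subset_span hu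
  have hL (e : ι × Bool) : knownDomain F e ([] : History ι V) ≤
      reached U ([] : History ι V) := bot_le
  have h := sum_runWords_le hρ ls us hmem [] hL (by simpa [hlen] using hM)
  have hnil : consistentTuples ρ ([] : History ι V) = Finset.univ := by
    ext x
    simp [Consistent]
  have hw : historyWeight p y U ([] : History ι V) = p ^ finrank F U := by
    have h0 (e : ι × Bool) : finrank F (knownDomain F e ([] : History ι V)) = 0 := finrank_bot F V
    rw [historyWeight, Finset.sum_eq_zero fun e _ => h0 e, pow_zero, mul_one, reached]
  rw [hnil, hw, hlen, Finset.card_univ] at h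
  have hone : ∀ x : ι → G, U.map (ρ (FreeGroup.lift x (FreeGroup.mk ls))⁻¹) = U →
      1 ≤ historyWeight p y U (runWords ρ x ls [] us) := by
    intro x hx
    have h2 := two_mul_finrank_le_of_le_doublyKnown
      (reached_le_doublyKnown ρ x hls hne hspan hx)
    have hp := hρ.p_pos
    calc (1 : ℝ) = (p * y ^ 2) ^ finrank F (reached U (runWords ρ x ls [] us)) := by
          rw [hρ.mul_sq, one_pow]
      _ = p ^ finrank F (reached U (runWords ρ x ls [] us)) *
            y ^ (2 * finrank F (reached U (runWords ρ x ls [] us))) := by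
          rw [mul_pow, ← pow_mul]
      _ ≤ _ := mul_le_mul_of_nonneg_left (pow_le_pow_right₀ hρ.one_le_y h2) (by positivity)
  have hnonneg : ∀ x : ι → G, 0 ≤ historyWeight p y U (runWords ρ x ls [] us) := fun x =>
    mul_nonneg (pow_nonneg hρ.p_pos.le _) (pow_nonneg (zero_le_one.trans hρ.one_le_y) _)
  calc _ = ∑ x : ι → G with U.map (ρ (FreeGroup.lift x (FreeGroup.mk ls))⁻¹) = U, (1 : ℝ) := by
        simp
    _ ≤ ∑ x : ι → G with U.map (ρ (FreeGroup.lift x (FreeGroup.mk ls))⁻¹) = U,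
          historyWeight p y U (runWords ρ x ls [] us) :=
        Finset.sum_le_sum fun x hx => hone x (Finset.mem_filter.1 hx).2
    _ ≤ ∑ x : ι → G, historyWeight p y U (runWords ρ x ls [] us) :=
        Finset.sum_le_sum_of_subset_of_nonneg (Finset.filter_subset _ _) fun x _ _ => hnonneg x
    _ ≤ _ := h
    _ = _ := by rw [mul_pow, ← pow_mul, mul_comm ls.length]; ring

end Run

end Counting

section Conjugation

variable {G ι : Type*} [Group G]

lemma lift_conj_apply (g : G) (x : ι → G) (w : FreeGroup ι) :
    FreeGroup.lift (fun i => g * x i * g⁻¹) w = g * FreeGroup.lift x w * g⁻¹ := by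
  have h : FreeGroup.lift (fun i => g * x i * g⁻¹) =
      (MulAut.conj g).toMonoidHom.comp (FreeGroup.lift x) := by
    ext i
    simp
  simp [h]

/-- Averaging a condition on the value of `w` over all its conjugates. -/
def prodLiftEquiv (P : G → Prop) (w : FreeGroup ι) :
    G × {x : ι → G // P (FreeGroup.lift x w)} ≃
      {z : G × (ι → G) // P (z.1⁻¹ * FreeGroup.lift z.2 w * z.1)} where
  toFun z := ⟨(z.1, fun i => z.1 * z.2.1 i * z.1⁻¹), by
    rw [lift_conj_apply]
    simpa [mul_assoc] using z.2.2⟩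
  invFun z := (z.1.1, ⟨fun i => z.1.1⁻¹ * z.1.2 i * z.1.1, by
    have h := lift_conj_apply z.1.1⁻¹ z.1.2 w
    rw [inv_inv] at h
    rw [h]
    exact z.2⟩)
  left_inv z := by ext <;> simp [mul_assoc]
  right_inv z := by ext <;> simp [mul_assoc]

/-- Conjugate words have equidistributed values. -/
lemma card_lift_conj [Finite G] (P : G → Prop) (v c : FreeGroup ι) :
    Nat.card {x : ι → G // P (FreeGroup.lift x (v * c * v⁻¹))} =
      Nat.card {x : ι → G // P (FreeGroup.lift x c)} := by
  have e : {z : G × (ι → G) // P (z.1⁻¹ * FreeGroup.lift z.2 (v * c * v⁻¹) * z.1)} ≃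
      {z : G × (ι → G) // P (z.1⁻¹ * FreeGroup.lift z.2 c * z.1)} :=
    Equiv.subtypeEquiv
      { toFun := fun z => ((FreeGroup.lift z.2 v)⁻¹ * z.1, z.2)
        invFun := fun z => (FreeGroup.lift z.2 v * z.1, z.2)
        left_inv := fun z => by simp
        right_inv := fun z => by simp }
      (fun z => by simp [mul_assoc])
  have h := Nat.card_congr (((prodLiftEquiv P (v * c * v⁻¹)).trans e).trans
    (prodLiftEquiv P c).symm)
  rw [Nat.card_prod, Nat.card_prod] at h
  exact Nat.eq_of_mul_eq_mul_left Nat.card_pos h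

end Conjugation

section SpecialLinear

variable {F : Type*} [Field F] {n : ℕ}

/-- The natural representation of a subgroup of `GL_n`. -/
def naturalRep (G : Subgroup (GL (Fin n) F)) : Representation F G (Fin n → F) :=
  (Matrix.toLinAlgEquiv' : Matrix (Fin n) (Fin n) F ≃ₐ[F] _).toMonoidHom.comp
    ((Units.coeHom _).comp G.subtype)

lemma naturalRep_apply (G : Subgroup (GL (Fin n) F)) (g : G) :
    naturalRep G g = Matrix.mulVecLin ((g : GL (Fin n) F) : Matrix (Fin n) (Fin n) F) := rfl

variable {G : Subgroup (GL (Fin n) F)}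

lemma exists_transvection_of_notMem
    (hG : ∀ A : Matrix.SpecialLinearGroup (Fin n) F, Matrix.SpecialLinearGroup.toGL A ∈ G)
    (R : Submodule F (Fin n → F)) {v v' : Fin n → F} (hv : v ∉ R) (hv' : v' ∉ R ⊔ F ∙ v) :
    ∃ g, (∀ y ∈ R, naturalRep G g y = y) ∧ naturalRep G g v = v' := by
  have hvP : v ∉ R ⊔ F ∙ (v' - v) := by
    intro h
    obtain ⟨s, hs, z, hz, hsz⟩ := mem_sup.1 h
    obtain ⟨c, rfl⟩ := mem_span_singleton.1 hz
    rcases eq_or_ne c 0 with rfl | hc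
    · rw [zero_smul, add_zero] at hsz
      exact hv (hsz ▸ hs)
    · refine hv' (mem_sup.2 ⟨-c⁻¹ • s, R.smul_mem _ hs, (1 + c⁻¹) • v,
        mem_span_singleton.2 ⟨_, rfl⟩, ?_⟩)
      have h1 : c⁻¹ • v = c⁻¹ • s + (v' - v) := by
        conv_lhs => rw [← hsz, smul_add, smul_smul, inv_mul_cancel₀ hc, one_smul]
      rw [add_smul, h1, one_smul, neg_smul]
      abel
  obtain ⟨f, hf, hker⟩ := exists_le_ker_of_notMem hvP
  set φ : Dual F (Fin n → F) := (f v)⁻¹ • f with hφ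
  have hφR : ∀ y ∈ R, φ y = 0 := fun y hy => by
    simp [hφ, LinearMap.mem_ker.1 (hker (mem_sup_left hy))]
  have hφu : φ (v' - v) = 0 := by
    rw [hφ, LinearMap.smul_apply,
      LinearMap.mem_ker.1 (hker (mem_sup_right (mem_span_singleton_self _))), smul_zero]
  have hφv : φ v = 1 := by simp [hφ, hf]
  let A : Matrix.SpecialLinearGroup (Fin n) F :=
    ⟨LinearMap.toMatrix' (LinearMap.transvection φ (v' - v)), by
      rw [LinearMap.det_toMatrix', LinearMap.transvection.det, hφu, add_zero]⟩
  have hA (y) : naturalRep G ⟨_, hG A⟩ y = y + φ y • (v' - v) := by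
    have : naturalRep G ⟨_, hG A⟩ = LinearMap.transvection φ (v' - v) :=
      (naturalRep_apply G _).trans (Matrix.toLin'_toMatrix' (LinearMap.transvection φ (v' - v)))
    rw [this, LinearMap.transvection.apply]
  refine ⟨⟨_, hG A⟩, fun y hy => ?_, ?_⟩
  · rw [hA, hφR y hy, zero_smul, add_zero]
  · rw [hA, hφv, one_smul, add_sub_cancel]

lemma transitiveOffSubspaces_naturalRep
    (hG : ∀ A : Matrix.SpecialLinearGroup (Fin n) F, Matrix.SpecialLinearGroup.toGL A ∈ G)
    {M : ℕ} (hM : M + 2 ≤ n) : TransitiveOffSubspaces (naturalRep G) M := by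
  intro R hR v hv v' hv'
  by_cases h : v' ∈ R ⊔ F ∙ v
  · have hlt : R ⊔ F ∙ v < ⊤ := by
      rw [lt_top_iff_ne_top]
      intro htop
      have h1 := finrank_add_le_finrank_add_finrank R (F ∙ v)
      have h2 := finrank_span_singleton_le (F := F) v
      rw [htop, finrank_top, finrank_fin_fun] at h1
      omega
    obtain ⟨z, -, hz⟩ := SetLike.exists_of_lt hlt
    have hzR : z ∉ R := fun hz' => hz (mem_sup_left hz')
    have hzv' : v' ∉ R ⊔ F ∙ z := by
      intro h'
      obtain ⟨s, hs, w, hw, hsw⟩ := mem_sup.1 h'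
      obtain ⟨c, rfl⟩ := mem_span_singleton.1 hw
      rcases eq_or_ne c 0 with rfl | hc
      · rw [zero_smul, add_zero] at hsw
        exact hv' (hsw ▸ hs)
      · refine hz ?_
        have : z = c⁻¹ • (v' - s) := by
          rw [← hsw, add_sub_cancel_left, smul_smul, inv_mul_cancel₀ hc, one_smul]
        rw [this]
        exact smul_mem _ _ (sub_mem h (mem_sup_left hs))
    obtain ⟨g, hg, hgv⟩ := exists_transvection_of_notMem hG R hv hz
    obtain ⟨g', hg', hgv'⟩ := exists_transvection_of_notMem hG R hzR hzv'
    refine ⟨g' * g, fun y hy => ?_, ?_⟩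
    · rw [map_mul, Module.End.mul_apply, hg y hy, hg' y hy]
    · rw [map_mul, Module.End.mul_apply, hgv, hgv']
  · exact exists_transvection_of_notMem hG R hv h

end SpecialLinear

section Estimate

/-- The numerical comparison behind the final bound: the left-hand side is the cost
per basis vector of a word of length `m`, and the exponent `N` plays the role of `ℓ r`. -/
lemma two_pow_mul_div_le {q n N m M r : ℕ} (hq : 2 ≤ q) (hN : 2 * N + 4 ≤ n)
    (hM : M + 1 ≤ n) (hmM : m + M ≤ 2 * N) :
    2 ^ m * ((q : ℝ) ^ M / ((q : ℝ) ^ n - (q : ℝ) ^ M)) ≤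
      (1 + (1 - (q : ℝ) ^ (-(r : ℝ)))⁻¹) * (q : ℝ) ^ (N : ℝ) /
        ((q : ℝ) ^ ((n : ℝ) - N - 1) - (q : ℝ) ^ (N : ℝ) - (q : ℝ) ^ ((n : ℝ) / 2)) := by
  obtain ⟨d, rfl⟩ : ∃ d, n = N + d + 1 := ⟨n - N - 1, by omega⟩
  have hq2 : (2 : ℝ) ≤ q := by exact_mod_cast hq
  have hq0 : (0 : ℝ) < q := by linarith
  have hq1 : (1 : ℝ) ≤ q := by linarith
  have hexp : (((N + d + 1 : ℕ) : ℝ) - N - 1) = d := by push_cast; ring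
  rw [hexp, Real.rpow_natCast, Real.rpow_natCast]
  have hC : 1 ≤ 1 + (1 - (q : ℝ) ^ (-(r : ℝ)))⁻¹ := by
    have h : (q : ℝ) ^ (-(r : ℝ)) ≤ 1 :=
      Real.rpow_le_one_of_one_le_of_nonpos hq1 (neg_nonpos.2 r.cast_nonneg)
    have := inv_nonneg.2 (sub_nonneg.2 h)
    linarith
  have hNd : (2 : ℝ) * N + 4 ≤ N + d + 1 := by exact_mod_cast hN
  have hhalf : (q : ℝ) ^ N < (q : ℝ) ^ (((N + d + 1 : ℕ) : ℝ) / 2) := by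
    rw [← Real.rpow_natCast]
    refine Real.rpow_lt_rpow_of_exponent_lt (by linarith) ?_
    push_cast
    linarith
  have hhalf' : (q : ℝ) ^ (((N + d + 1 : ℕ) : ℝ) / 2) * q ≤ (q : ℝ) ^ d := by
    rw [← Real.rpow_natCast (q : ℝ) d, ← Real.rpow_add_one hq0.ne']
    refine Real.rpow_le_rpow_of_exponent_le hq1 ?_
    push_cast
    linarith
  set h := (q : ℝ) ^ (((N + d + 1 : ℕ) : ℝ) / 2)
  have hh : 0 < h := (pow_pos hq0 N).trans hhalf
  have hD : 0 < (q : ℝ) ^ d - (q : ℝ) ^ N - h := by nlinarith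
  have hMle : (q : ℝ) ^ M ≤ (q : ℝ) ^ (N + d) := pow_le_pow_right₀ hq1 (by omega)
  have hpos : 0 < (q : ℝ) ^ (N + d) := by positivity
  have hden : (q : ℝ) ^ (N + d) ≤ (q : ℝ) ^ (N + d + 1) - (q : ℝ) ^ M := by
    rw [pow_succ]
    nlinarith
  calc 2 ^ m * ((q : ℝ) ^ M / ((q : ℝ) ^ (N + d + 1) - (q : ℝ) ^ M))
      ≤ (q : ℝ) ^ m * ((q : ℝ) ^ M / (q : ℝ) ^ (N + d)) := by
        have := hpos.trans_le hden
        gcongr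
    _ = (q : ℝ) ^ (m + M) / (q : ℝ) ^ (N + d) := by rw [pow_add]; ring
    _ ≤ (q : ℝ) ^ (2 * N) / (q : ℝ) ^ (N + d) := by gcongr
    _ = 1 * (q : ℝ) ^ N / (q : ℝ) ^ d := by
        rw [two_mul, pow_add, pow_add, one_mul, mul_div_mul_left _ _ (pow_pos hq0 N).ne']
    _ ≤ _ := by
        have := pow_pos hq0 N
        gcongr
        linarith

end Estimate

section Assembly

variable {F : Type*} [Field F] [Fintype F] {n : ℕ} {G : Subgroup (GL (Fin n) F)}

lemma weightParams_naturalRep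
    (hG : ∀ A : Matrix.SpecialLinearGroup (Fin n) F, Matrix.SpecialLinearGroup.toGL A ∈ G)
    {M : ℕ} (hM : M + 2 ≤ n) {p : ℝ}
    (hp : p = (Fintype.card F : ℝ) ^ M / ((Fintype.card F : ℝ) ^ n - (Fintype.card F : ℝ) ^ M)) :
    WeightParams (naturalRep G) M p (√p)⁻¹ := by
  have hq2 : (2 : ℝ) ≤ Fintype.card F := by exact_mod_cast Fintype.one_lt_card (α := F)
  have hMpos : 0 < (Fintype.card F : ℝ) ^ M := by positivity
  have hle : 2 * (Fintype.card F : ℝ) ^ M ≤ (Fintype.card F : ℝ) ^ n :=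
    calc 2 * (Fintype.card F : ℝ) ^ M ≤ (Fintype.card F : ℝ) ^ (M + 1) := by
          rw [pow_succ']
          gcongr
      _ ≤ _ := pow_le_pow_right₀ (by linarith) (by omega)
  have hden : 0 < (Fintype.card F : ℝ) ^ n - (Fintype.card F : ℝ) ^ M := by linarith
  have hp0 : 0 < p := hp ▸ div_pos hMpos hden
  have hp1 : p ≤ 1 := by
    rw [hp, div_le_one hden]
    linarith
  exact
    { transitive := transitiveOffSubspaces_naturalRep hG hM
      lt_finrank := by
        rw [finrank_fin_fun]
        omega
      p_pos := hp0
      one_le_y := (one_le_inv₀ (Real.sqrt_pos.2 hp0)).2 (Real.sqrt_le_one.2 hp1)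
      mul_sq := by rw [inv_pow, Real.sq_sqrt hp0.le, mul_inv_cancel₀ hp0.ne']
      card_pow := by rw [hp, finrank_fin_fun, div_mul_cancel₀ _ hden.ne'] }

lemma map_inv_eq_iff {K V H : Type*} [Field K] [AddCommGroup V] [Module K V] [Group H]
    (ρ : Representation K H V) (g : H) (U : Submodule K V) :
    U.map (ρ g⁻¹) = U ↔ U.map (ρ g) = U := by
  have h (a : H) : U.map (ρ a) = U → U.map (ρ a⁻¹) = U := fun ha => by
    conv_lhs => rw [← ha]
    rw [← Submodule.map_comp, ← Module.End.mul_eq_comp, ← map_mul, inv_mul_cancel, map_one,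
      Module.End.one_eq_id, Submodule.map_id]
  exact ⟨fun hg => inv_inv g ▸ h _ hg, h g⟩

/-- A nontrivial word is conjugate to a nonempty cyclically reduced word which is not longer. -/
lemma exists_conj_mk_isCyclicallyReduced {ι : Type*} [DecidableEq ι] {w : FreeGroup ι}
    (hw : w ≠ 1) :
    ∃ (v : FreeGroup ι) (ls : List (ι × Bool)), FreeGroup.IsCyclicallyReduced ls ∧ ls ≠ [] ∧
      ls.length ≤ w.norm ∧ w = v * FreeGroup.mk ls * v⁻¹ := by
  have h := FreeGroup.reduceCyclically.conj_conjugator_reduceCyclically w.toWord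
  have hmk : w = FreeGroup.mk (FreeGroup.reduceCyclically.conjugator w.toWord) *
      FreeGroup.mk (FreeGroup.reduceCyclically w.toWord) *
      (FreeGroup.mk (FreeGroup.reduceCyclically.conjugator w.toWord))⁻¹ := by
    rw [FreeGroup.inv_mk, FreeGroup.mul_mk, FreeGroup.mul_mk, h, FreeGroup.mk_toWord]
  refine ⟨_, _, FreeGroup.reduceCyclically.isCyclicallyReduced FreeGroup.isReduced_toWord,
    fun h0 => hw ?_, ?_, hmk⟩
  · rw [hmk, h0, ← FreeGroup.one_eq_mk, mul_one, mul_inv_cancel]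
  · have := congrArg List.length h
    simp only [List.length_append] at this
    rw [FreeGroup.norm]
    omega

end Assembly

/-- **The probability that a short word fixes a given subspace** (Lemma 4.1,
linear case). Let `SL_n(q) ≤ G ≤ GL_n(q)`, let `U ≤ F_q^n` be a subspace of
dimension `r` with `1 ≤ r ≤ n - 2`, and let `w ∈ F_k` be a nontrivial word of
reduced length `ℓ ≤ (n/2 - 2)/r`. For uniformly random `x_1, …, x_k ∈ G`, the
probability that `w(x_1, …, x_k)·U = U` is at most
`(C_{q^r} · q^{ℓr} / (q^{n-ℓr-1} - q^{ℓr} - q^{n/2}))^r` where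
`C_{q^r} = 1 + (1 - q^{-r})⁻¹`. -/
theorem stmt6 (F : Type) [Field F] [Fintype F] (n k r : ℕ)
    (hn : 0 < n) (hk : 0 < k) (hr : 1 ≤ r) (hr' : r ≤ n - 2)
    (G : Subgroup (GL (Fin n) F))
    (hG : ∀ A : Matrix.SpecialLinearGroup (Fin n) F,
      Matrix.SpecialLinearGroup.toGL A ∈ G)
    (U : Submodule F (Fin n → F)) (hU : Module.finrank F ↥U = r)
    (w : FreeGroup (Fin k)) (hw : w ≠ 1)
    (hℓ : (w.norm : ℝ) ≤ ((n : ℝ) / 2 - 2) / r) :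
    (Nat.card {x : Fin k → ↥G //
        Submodule.map
          (Matrix.mulVecLin
            (((FreeGroup.lift x w : ↥G) : GL (Fin n) F) : Matrix (Fin n) (Fin n) F))
          U = U} : ℝ) / (Nat.card ↥G : ℝ) ^ k ≤
      ((1 + (1 - (Fintype.card F : ℝ) ^ (-(r : ℝ)))⁻¹) *
          (Fintype.card F : ℝ) ^ ((w.norm : ℝ) * r) /
        ((Fintype.card F : ℝ) ^ ((n : ℝ) - w.norm * r - 1) -
          (Fintype.card F : ℝ) ^ ((w.norm : ℝ) * r) -
          (Fintype.card F : ℝ) ^ ((n : ℝ) / 2))) ^ r := by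
  classical
  obtain ⟨v, ls, hls, hne, hlen, rfl⟩ := exists_conj_mk_isCyclicallyReduced hw
  set ℓ := (v * FreeGroup.mk ls * v⁻¹).norm
  have hr0 : (0 : ℝ) < r := by exact_mod_cast hr
  have hN : 2 * (ℓ * r) + 4 ≤ n := by
    rw [le_div_iff₀ hr0] at hℓ
    have : (2 : ℝ) * (ℓ * r) + 4 ≤ n := by linarith
    exact_mod_cast this
  have hm : 1 ≤ ls.length := List.length_pos_iff.2 hne
  obtain ⟨m, hm'⟩ : ∃ m, ls.length = m + 1 := ⟨ls.length - 1, by omega⟩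
  obtain ⟨s, rfl⟩ : ∃ s, r = s + 1 := ⟨r - 1, by omega⟩
  have hlr : ls.length * (s + 1) ≤ ℓ * (s + 1) := Nat.mul_le_mul_right _ hlen
  obtain ⟨M, hM⟩ : ∃ M, M + 1 = (s + 1) + (s + 1) * ls.length :=
    ⟨s + (s + 1) * ls.length, by ring⟩
  have hmM : ls.length + M ≤ 2 * (ℓ * (s + 1)) := by
    rw [hm'] at hlr hM ⊢
    nlinarith
  have hMn : M + 2 ≤ n := by omega
  set p : ℝ := (Fintype.card F : ℝ) ^ M / ((Fintype.card F : ℝ) ^ n - (Fintype.card F : ℝ) ^ M)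
    with hp
  have hρ := weightParams_naturalRep hG hMn hp
  have hcount := card_stabilizing_le (U := U) hρ hls hne (by rw [hU, hM])
  have hcard : Nat.card {x : Fin k → ↥G // Submodule.map (Matrix.mulVecLin
      (((FreeGroup.lift x (v * FreeGroup.mk ls * v⁻¹) : ↥G) : GL (Fin n) F) :
        Matrix (Fin n) (Fin n) F)) U = U} =
      (Finset.univ.filter fun x : Fin k → G =>
        U.map (naturalRep G (FreeGroup.lift x (FreeGroup.mk ls))⁻¹) = U).card := by
    rw [← Fintype.card_subtype, ← Nat.card_eq_fintype_card]
    simp_rw [map_inv_eq_iff]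
    exact card_lift_conj (fun g : G => U.map (naturalRep G g) = U) v (FreeGroup.mk ls)
  rw [hU, Fintype.card_fun, Fintype.card_fin, ← Nat.card_eq_fintype_card, Nat.cast_pow] at hcount
  rw [hcard, div_le_iff₀ (pow_pos (Nat.cast_pos.2 Nat.card_pos) k)]
  refine hcount.trans (mul_le_mul_of_nonneg_right ?_ (by positivity))
  have hp0 := hρ.p_pos
  refine pow_le_pow_left₀ (by positivity) ?_ _
  have := two_pow_mul_div_le (q := Fintype.card F) (r := s + 1) Fintype.one_lt_card hN
    (by omega : M + 1 ≤ n) hmM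
  rwa [Nat.cast_mul] at this
end

section
/- Let G be a finite group, k ≥ 1 and ℓ ≥ 1 integers, and let f be a nonnegative real-valued class function on G with ‖f‖_1 > 0. Let w denote the result of a simple random walk of length 2ℓ in F_k. Let B ≥ 0 be a real number, and suppose that for every nontrivial irreducible character χ of G with ⟨f, χ⟩ ≠ 0, the expectation, jointly over w and over independent uniform x_1, …, x_k ∈ G, of Re(χ(w(x_1, …, x_k))) / χ(1) is at most B. Choose x_0, x_1, …, x_k independently and uniformly at random from G, and let E be the event that f(x_0 · u(x_1, …, x_k)) = 0 for every word u ∈ F_k of reduced length at most ℓ. Then the probability of E is at most (‖f‖_2² / ‖f‖_1²) · B. -/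
open CategoryTheory

/-- The word `s_ℓ ⋯ s_1 ∈ F_k` determined by a sequence of `ℓ` steps, with each
step `s_t = (i, b)` standing for `ξ_i` if `b = true` and `ξ_i⁻¹` if `b = false`.
A uniformly random `s : Fin ℓ → Fin k × Bool` thus gives the result of a simple
random walk of length `ℓ` in `F_k`. -/
def walkWord {k ℓ : ℕ} (s : Fin ℓ → Fin k × Bool) : FreeGroup (Fin k) :=
  (List.ofFn fun t : Fin ℓ =>
    if (s t).2 then FreeGroup.of (s t).1 else (FreeGroup.of (s t).1)⁻¹).reverse.prod

section Representations

variable {G : Type} [Group G]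

/-- In a finite-dimensional unitary representation, every subrepresentation that is not orthogonal
to `φ` contains an irreducible subrepresentation that is not orthogonal to `φ`. -/
lemma exists_irreducible_inner_ne_zero {E : Type*} [NormedAddCommGroup E] [InnerProductSpace ℂ E]
    [FiniteDimensional ℂ E] (ρ : Representation ℂ G E)
    (hρ : ∀ g u v, inner ℂ (ρ g u) v = inner ℂ u (ρ g⁻¹ v)) (φ : E) (S : Subrepresentation ρ)
    (hS : ∃ v ∈ S.toSubmodule, inner ℂ v φ ≠ 0) :
    ∃ W : Subrepresentation ρ, W.toSubmodule ≤ S.toSubmodule ∧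
      W.toRepresentation.IsIrreducible ∧ ∃ v ∈ W.toSubmodule, inner ℂ v φ ≠ 0 := by
  induction hn : Module.finrank ℂ S.toSubmodule using Nat.strong_induction_on generalizing S with
  | _ n ih =>
  by_cases hirr : S.toRepresentation.IsIrreducible
  · exact ⟨S, le_rfl, hirr, hS⟩
  have hproper : ∀ U : Subrepresentation ρ, U.toSubmodule < S.toSubmodule →
      (∃ v ∈ U.toSubmodule, inner ℂ v φ ≠ 0) →
      ∃ W : Subrepresentation ρ, W.toSubmodule ≤ S.toSubmodule ∧
        W.toRepresentation.IsIrreducible ∧ ∃ v ∈ W.toSubmodule, inner ℂ v φ ≠ 0 := by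
    intro U hU hUφ
    obtain ⟨W, hWU, hW⟩ := ih _ (hn ▸ Submodule.finrank_lt_finrank_of_lt hU) U hUφ rfl
    exact ⟨W, hWU.trans hU.le, hW⟩
  obtain ⟨v, hvS, hvφ⟩ := hS
  have hsub : ∃ U : Subrepresentation ρ, U.toSubmodule < S.toSubmodule ∧ U.toSubmodule ≠ ⊥ := by
    by_contra! hcon
    refine hirr { exists_pair_ne := ⟨⊥, ⊤, fun h ↦ ?_⟩, eq_bot_or_eq_top := fun U ↦ ?_ }
    · have hmem : (⟨v, hvS⟩ : S.toSubmodule) ∈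
          (⊥ : Subrepresentation S.toRepresentation).toSubmodule := by
        rw [h]; exact Submodule.mem_top
      have h0 : (⟨v, hvS⟩ : S.toSubmodule) = 0 := (Submodule.mem_bot ℂ).1 hmem
      have : v = 0 := congrArg Subtype.val h0
      simp [this] at hvφ
    · let U' : Subrepresentation ρ :=
        { toSubmodule := U.toSubmodule.map S.toSubmodule.subtype
          apply_mem_toSubmodule := by
            rintro g _ ⟨u, hu, rfl⟩
            exact ⟨_, U.apply_mem_toSubmodule g hu, rfl⟩ }
      have hle : U'.toSubmodule ≤ S.toSubmodule := Submodule.map_subtype_le _ _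
      rcases hle.lt_or_eq with hlt | heq
      · left
        apply Subrepresentation.toSubmodule_injective
        refine Submodule.map_injective_of_injective S.toSubmodule.injective_subtype ?_
        exact (hcon U' hlt).trans (Submodule.map_bot _).symm
      · right
        apply Subrepresentation.toSubmodule_injective
        refine Submodule.map_injective_of_injective S.toSubmodule.injective_subtype ?_
        change U'.toSubmodule = Submodule.map S.toSubmodule.subtype ⊤
        rw [heq, Submodule.map_subtype_top]
  obtain ⟨U, hUS, hU0⟩ := hsub
  by_cases hUφ : ∃ u ∈ U.toSubmodule, inner ℂ u φ ≠ 0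
  · exact hproper U hUS hUφ
  push Not at hUφ
  let U' : Subrepresentation ρ :=
    { toSubmodule := U.toSubmoduleᗮ ⊓ S.toSubmodule
      apply_mem_toSubmodule := by
        rintro g w ⟨hw, hwS⟩
        refine ⟨(Submodule.mem_orthogonal' _ _).2 fun u hu ↦ ?_, S.apply_mem_toSubmodule g hwS⟩
        rw [hρ]
        exact (Submodule.mem_orthogonal' _ _).1 hw _ (U.apply_mem_toSubmodule _ hu) }
  refine hproper U' (lt_of_le_of_ne inf_le_right fun h ↦ ?_) ?_
  · obtain ⟨u, hu, hu0⟩ := Submodule.exists_mem_ne_zero_of_ne_bot hU0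
    have hmem : u ∈ U'.toSubmodule := h ▸ hUS.le hu
    exact hu0 (inner_self_eq_zero.1 ((Submodule.mem_orthogonal _ _).1 hmem.1 u hu))
  · obtain ⟨a, ha, b, hb, rfl⟩ := U.toSubmodule.exists_add_mem_mem_orthogonal v
    refine ⟨b, ⟨hb, ?_⟩, ?_⟩
    · simpa using S.toSubmodule.sub_mem hvS (hUS.le ha)
    · rwa [inner_add_left, hUφ a ha, zero_add] at hvφ

/-- If a class function has zero pairing with the character of an irreducible representation, then
it acts on that representation by zero. -/
lemma sum_smul_eq_zero_of_sum_mul_character_eq_zero [Fintype G] {V : Type*} [AddCommGroup V]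
    [Module ℂ V] [FiniteDimensional ℂ V] (σ : Representation ℂ G V) [hσ : σ.IsIrreducible]
    (c : G → ℂ) (hc : ∀ x y, c (y * x * y⁻¹) = c x) (h : ∑ x, c x * σ.character x = 0) :
    ∑ x, c x • σ x = 0 := by
  let P : Representation.IntertwiningMap σ σ :=
    { toLinearMap := ∑ x, c x • σ x
      isIntertwining' := fun g ↦ by
        change (∑ x, c x • σ x) * σ g = σ g * ∑ x, c x • σ x
        rw [Finset.sum_mul, Finset.mul_sum]
        refine Fintype.sum_equiv (MulAut.conj g⁻¹).toEquiv _ _ fun x ↦ ?_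
        have hx := hc x g⁻¹
        simp only [MulEquiv.toEquiv_eq_coe, MulEquiv.coe_toEquiv, MulAut.conj_apply, hx]
        rw [smul_mul_assoc, mul_smul_comm, ← map_mul, ← map_mul]
        congr 2
        group }
  obtain ⟨a, ha⟩ :=
    (Representation.IsIrreducible.algebraMap_intertwiningMap_bijective_of_isAlgClosed
      (ρ := σ)).surjective P
  have hP : ∑ x, c x • σ x = a • (1 : V →ₗ[ℂ] V) := by
    have := congrArg Representation.IntertwiningMap.toLinearMap ha
    rw [Algebra.algebraMap_eq_smul_one] at this
    exact this.symm
  have htr := congrArg (LinearMap.trace ℂ V) hP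
  simp only [map_sum, map_smul, smul_eq_mul, LinearMap.trace_one] at htr
  have hnt : Nontrivial V := by
    by_contra hV
    rw [not_nontrivial_iff_subsingleton] at hV
    exact bot_ne_top (α := Subrepresentation σ)
      (Subrepresentation.toSubmodule_injective (Subsingleton.elim _ _))
  have ha0 : a = 0 := by
    have h' : a * (Module.finrank ℂ V : ℂ) = 0 := htr.symm.trans h
    simpa [Module.finrank_pos.ne'] using h'
  rw [hP, ha0, zero_smul]

lemma isIrreducible_trivial : (Representation.trivial ℂ G ℂ).IsIrreducible where
  exists_pair_ne := ⟨⊥, ⊤, fun h ↦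
    bot_ne_top (α := Submodule ℂ ℂ) (congrArg Subrepresentation.toSubmodule h)⟩
  eq_bot_or_eq_top U := (eq_bot_or_eq_top U.toSubmodule).imp
    (fun h ↦ Subrepresentation.toSubmodule_injective h)
    (fun h ↦ Subrepresentation.toSubmodule_injective h)

lemma simple_of_isIrreducible [Fintype G] {V : Type} [AddCommGroup V]
    [Module ℂ V] [FiniteDimensional ℂ V] (σ : Representation ℂ G V) [hσ : σ.IsIrreducible] :
    Simple (FDRep.of σ) := by
  have hcard : (Nat.card G : ℂ) ≠ 0 := Nat.cast_ne_zero.2 Nat.card_pos.ne'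
  have := invertibleOfNonzero hcard
  rw [FDRep.simple_iff_char_is_norm_one]
  have h := Representation.char_orthonormal σ σ
  rw [if_pos ⟨Representation.Equiv.refl σ⟩, inv_mul_eq_iff_eq_mul₀ hcard, mul_one] at h
  exact h

/-- The values of a nontrivial irreducible character sum to zero. -/
lemma sum_character_eq_zero [Fintype G] (V : FDRep ℂ G) [Simple V]
    (h : V.character ≠ fun _ ↦ 1) : ∑ x, V.character x = 0 := by
  have := isIrreducible_trivial (G := G)
  have := simple_of_isIrreducible (Representation.trivial ℂ G ℂ)
  have hchar : (FDRep.of (Representation.trivial ℂ G ℂ)).character = fun _ ↦ 1 := by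
    ext g
    exact (LinearMap.trace_one ℂ ℂ).trans (by simp)
  have := invertibleOfNonzero (Nat.cast_ne_zero.2 Nat.card_pos.ne' : (Nat.card G : ℂ) ≠ 0)
  have horth := FDRep.char_orthonormal V (FDRep.of (Representation.trivial ℂ G ℂ))
  rw [if_neg (fun ⟨e⟩ ↦ h ((FDRep.char_iso e).trans hchar))] at horth
  simpa [hchar] using horth

end Representations

section RegularRepresentation

variable {G : Type} [Group G] [Fintype G]

/-- The right regular representation of `G` on `ℓ²(G)`. -/
noncomputable def rightRegular (G : Type) [Group G] [Fintype G] :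
    Representation ℂ G (EuclideanSpace ℂ G) where
  toFun g :=
    { toFun := fun v ↦ WithLp.toLp 2 fun x ↦ v (x * g)
      map_add' := fun _ _ ↦ rfl
      map_smul' := fun _ _ ↦ rfl }
  map_one' := by ext v x; simp
  map_mul' g h := by ext v x; exact congrArg v.ofLp (mul_assoc x g h).symm

@[simp]
lemma rightRegular_apply (g : G) (v : EuclideanSpace ℂ G) (x : G) :
    rightRegular G g v x = v (x * g) := rfl

lemma inner_rightRegular (g : G) (u v : EuclideanSpace ℂ G) :
    inner ℂ (rightRegular G g u) v = inner ℂ u (rightRegular G g⁻¹ v) := by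
  simp only [PiLp.inner_apply, rightRegular_apply]
  exact Fintype.sum_equiv (Equiv.mulRight g) _ _ fun x ↦ by simp

/-- A subrepresentation of the regular representation on which the real function `φ` acts by zero is
orthogonal to `φ`. -/
lemma inner_eq_zero_of_sum_smul_eq_zero (φ : G → ℝ) (W : Subrepresentation (rightRegular G))
    (h : ∑ x, (φ x : ℂ) • W.toRepresentation x = 0) {v : EuclideanSpace ℂ G}
    (hv : v ∈ W.toSubmodule) :
    inner ℂ v (WithLp.toLp 2 fun x ↦ (φ x : ℂ)) = 0 := by
  have h1 := congrArg (fun T ↦ ((T ⟨v, hv⟩ : W.toSubmodule) : EuclideanSpace ℂ G) 1) h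
  have h2 : ∑ x, (φ x : ℂ) * v x = 0 := by
    simpa [Subrepresentation.toRepresentation] using h1
  have h3 := congrArg (starRingEnd ℂ) h2
  simpa [PiLp.inner_apply] using h3

/-- A bound for the quadratic form of a sum of translations at a mean-zero class function, in terms
of the characters that occur in that function. -/
lemma inner_sum_rightRegular_le {J : Type*} [Fintype J] (a : J → G) (φ : G → ℝ)
    (hφ : ∀ x y, φ (y * x * y⁻¹) = φ x) (hφ0 : ∑ x, φ x = 0)
    (hsymm : (∑ j, rightRegular G (a j)).IsSymmetric)
    (hcomm : ∀ g, Commute (rightRegular G g) (∑ j, rightRegular G (a j))) (C : ℝ)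
    (hC : ∀ V : FDRep ℂ G, Simple V → V.character ≠ (fun _ ↦ 1) →
      ∑ x, (φ x : ℂ) * V.character x ≠ 0 →
      ∑ j, (V.character (a j)).re / (V.character 1).re ≤ C) :
    (inner ℂ ((∑ j, rightRegular G (a j)) (WithLp.toLp 2 fun x ↦ (φ x : ℂ)))
      (WithLp.toLp 2 fun x ↦ (φ x : ℂ))).re ≤ C * ∑ x, φ x ^ 2 := by
  set T := ∑ j, rightRegular G (a j) with hT
  set v : EuclideanSpace ℂ G := WithLp.toLp 2 fun x ↦ (φ x : ℂ) with hv
  let b := hsymm.eigenvectorBasis rfl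
  have heig : ∀ i, inner ℂ (b i) v ≠ 0 → hsymm.eigenvalues rfl i ≤ C := by
    intro i hi
    set μ := hsymm.eigenvalues rfl i
    let S : Subrepresentation (rightRegular G) :=
      { toSubmodule := Module.End.eigenspace T (μ : ℂ)
        apply_mem_toSubmodule := fun g w hw ↦ by
          rw [Module.End.mem_eigenspace_iff] at hw ⊢
          have := LinearMap.congr_fun (hcomm g).eq w
          simp only [Module.End.mul_apply] at this
          rw [← this, hw, map_smul] }
    obtain ⟨W, hWS, hW, w, hwW, hwφ⟩ :=
      exists_irreducible_inner_ne_zero (rightRegular G) inner_rightRegular v S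
        ⟨b i, (hsymm.hasEigenvector_eigenvectorBasis rfl i).1, hi⟩
    have hne : ∑ x, (φ x : ℂ) * W.toRepresentation.character x ≠ 0 := fun h ↦
      hwφ (inner_eq_zero_of_sum_smul_eq_zero φ W
        (sum_smul_eq_zero_of_sum_mul_character_eq_zero W.toRepresentation _
          (fun x y ↦ by rw [hφ]) h) hwW)
    have hnt : W.toRepresentation.character ≠ fun _ ↦ 1 := fun h ↦ by
      apply hne
      simp only [h, mul_one]
      exact_mod_cast hφ0
    have hbound := hC (FDRep.of W.toRepresentation) (simple_of_isIrreducible _) hnt hne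
    have hact : ∑ j, W.toRepresentation (a j) = (μ : ℂ) • 1 := by
      ext u : 2
      have := Module.End.mem_eigenspace_iff.1 (hWS u.2)
      rw [hT] at this
      simpa [LinearMap.sum_apply, Subrepresentation.toRepresentation] using this
    have htr := congrArg (LinearMap.trace ℂ _) hact
    simp only [map_sum, map_smul, smul_eq_mul, LinearMap.trace_one] at htr
    have hpos : 0 < Module.finrank ℂ W.toSubmodule := by
      have : Nontrivial W.toSubmodule :=
        ⟨⟨w, hwW⟩, 0, fun h ↦ hwφ (by
          rw [show w = 0 from congrArg Subtype.val h, inner_zero_left])⟩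
      exact Module.finrank_pos
    have hre := congrArg Complex.re htr
    rw [Complex.re_sum, Complex.re_ofReal_mul, Complex.natCast_re] at hre
    rw [← Finset.sum_div, FDRep.char_one] at hbound
    refine le_trans (le_of_eq ?_) hbound
    rw [Complex.natCast_re, eq_div_iff (by exact_mod_cast hpos.ne')]
    exact hre.symm
  have hexpand : inner ℂ (T v) v =
      ∑ i, ((hsymm.eigenvalues rfl i * ‖inner ℂ (b i) v‖ ^ 2 : ℝ) : ℂ) := by
    rw [← b.sum_inner_mul_inner]
    refine Finset.sum_congr rfl fun i _ ↦ ?_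
    rw [hsymm v (b i), hsymm.apply_eigenvectorBasis rfl i, inner_smul_right, mul_assoc,
      ← inner_conj_symm v, RCLike.conj_mul]
    push_cast
    rfl
  have hnorm : ∑ i, ‖inner ℂ (b i) v‖ ^ 2 = ∑ x, φ x ^ 2 := by
    rw [b.sum_sq_norm_inner_right, EuclideanSpace.norm_sq_eq]
    simp [hv]
  rw [hexpand, ← Complex.ofReal_sum, Complex.ofReal_re, ← hnorm, Finset.mul_sum]
  refine Finset.sum_le_sum fun i _ ↦ ?_
  by_cases hi : inner ℂ (b i) v = 0
  · simp [hi]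
  · exact mul_le_mul_of_nonneg_right (heig i hi) (sq_nonneg _)

end RegularRepresentation

section RandomWalk

variable {G : Type} [Group G] {k : ℕ}

/-- The element of `G` taken by the step `p` of a walk driven by `x : Fin k → G`. -/
def stepValue (x : Fin k → G) (p : Fin k × Bool) : G := if p.2 then x p.1 else (x p.1)⁻¹

lemma walkWord_cons {n : ℕ} (p : Fin k × Bool) (s : Fin n → Fin k × Bool) :
    walkWord (Fin.cons p s : Fin (n + 1) → Fin k × Bool) =
      walkWord s * if p.2 then FreeGroup.of p.1 else (FreeGroup.of p.1)⁻¹ := by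
  simp [walkWord, List.ofFn_succ]

lemma lift_walkWord_cons {n : ℕ} (x : Fin k → G) (p : Fin k × Bool) (s : Fin n → Fin k × Bool) :
    FreeGroup.lift x (walkWord (Fin.cons p s : Fin (n + 1) → Fin k × Bool)) =
      FreeGroup.lift x (walkWord s) * stepValue x p := by
  rw [walkWord_cons, map_mul, stepValue]
  split <;> simp

lemma norm_walkWord_le {n : ℕ} (s : Fin n → Fin k × Bool) : (walkWord s).norm ≤ n := by
  induction n with
  | zero => simp [walkWord]
  | succ n ih =>
    rw [← Fin.cons_self_tail s, walkWord_cons]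
    refine (FreeGroup.norm_mul_le _ _).trans (add_le_add (ih _) ?_)
    split <;> simp

lemma lift_conj (x : Fin k → G) (g : G) (w : FreeGroup (Fin k)) :
    FreeGroup.lift (fun i ↦ g * x i * g⁻¹) w = g * FreeGroup.lift x w * g⁻¹ := by
  have : FreeGroup.lift (fun i ↦ g * x i * g⁻¹) =
      (MulAut.conj g).toMonoidHom.comp (FreeGroup.lift x) := by
    ext i
    simp
  simp [this]

variable [Fintype G]

/-- The (unnormalized) Markov operator of the walk on `G` driven by `x`. -/
noncomputable def stepOperator (x : Fin k → G) : Module.End ℂ (EuclideanSpace ℂ G) :=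
  ∑ p, rightRegular G (stepValue x p)

lemma sum_rightRegular_walkWord (x : Fin k → G) (n : ℕ) :
    ∑ s : Fin n → Fin k × Bool, rightRegular G (FreeGroup.lift x (walkWord s)) =
      stepOperator x ^ n := by
  induction n with
  | zero => simp [walkWord]
  | succ n ih =>
    rw [← (Fin.consEquiv fun _ : Fin (n + 1) ↦ Fin k × Bool).sum_comp, Fintype.sum_prod_type_right,
      pow_succ, ← ih, Finset.sum_mul]
    refine Finset.sum_congr rfl fun s _ ↦ ?_
    rw [stepOperator, Finset.mul_sum]
    refine Finset.sum_congr rfl fun p _ ↦ ?_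
    rw [← map_mul, ← lift_walkWord_cons]
    rfl

lemma isSymmetric_stepOperator (x : Fin k → G) : (stepOperator x).IsSymmetric := by
  intro u v
  simp only [stepOperator, LinearMap.sum_apply, sum_inner, inner_sum, inner_rightRegular]
  refine Fintype.sum_equiv ((Equiv.refl _).prodCongr Equiv.boolNot) _ _ fun p ↦ ?_
  rcases p with ⟨i, _ | _⟩ <;> simp [stepValue]

lemma inner_stepOperator_pow (x : Fin k → G) (n : ℕ) (v : EuclideanSpace ℂ G) :
    inner ℂ ((stepOperator x ^ (2 * n)) v) v = ((‖(stepOperator x ^ n) v‖ ^ 2 : ℝ) : ℂ) := by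
  rw [two_mul, pow_add, Module.End.mul_apply, (isSymmetric_stepOperator x).pow n,
    inner_self_eq_norm_sq_to_K]
  push_cast
  rfl

/-- If `f` vanishes at every point `x₀ u(x)` with `u` of length at most `n`, then the centred
function `f - m` has value `-(2k)ⁿ m` at `x₀` after `n` steps. -/
lemma stepOperator_pow_apply_of_forall_eq_zero (f : G → ℝ) (m : ℝ) (n : ℕ) (x₀ : G) (x : Fin k → G)
    (h : ∀ u : FreeGroup (Fin k), u.norm ≤ n → f (x₀ * FreeGroup.lift x u) = 0) :
    (stepOperator x ^ n) (WithLp.toLp 2 fun y ↦ ((f y - m : ℝ) : ℂ)) x₀ =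
      ((-((2 * k : ℕ) : ℝ) ^ n * m : ℝ) : ℂ) := by
  rw [← sum_rightRegular_walkWord, LinearMap.sum_apply, WithLp.ofLp_sum, Finset.sum_apply]
  simp only [rightRegular_apply, h _ (norm_walkWord_le _)]
  simp [mul_comm k 2]

end RandomWalk

/-- **The `x·w(y, z)` trick, general form** (Theorem 5.1). Let `G` be a finite
group, `f` a nonnegative class function on `G` with `‖f‖₁ > 0`, and `B ≥ 0`.
Suppose that for every nontrivial irreducible character `χ` of `G` with
`⟨f, χ⟩ ≠ 0`, the expectation (jointly over a random walk `w` of length `2ℓ` in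
`F_k` and independent uniform `x_1, …, x_k ∈ G`) of `Re χ(w(x_1, …, x_k))/χ(1)`
is at most `B`. Then for independent uniform `x_0, x_1, …, x_k ∈ G`, the
probability that `f(x_0·u(x_1, …, x_k)) = 0` for every word `u ∈ F_k` of reduced
length at most `ℓ` is at most `(‖f‖₂²/‖f‖₁²)·B`. -/
theorem stmt11 (G : Type) [Group G] [Fintype G] (k ℓ : ℕ) (hk : 1 ≤ k) (hℓ : 1 ≤ ℓ)
    (f : G → ℝ) (hf0 : ∀ x : G, 0 ≤ f x)
    (hfclass : ∀ x y : G, f (y * x * y⁻¹) = f x)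
    (hf1 : 0 < (∑ x : G, |f x|) / (Fintype.card G : ℝ))
    (B : ℝ) (hB : 0 ≤ B)
    (hexp : ∀ V : FDRep ℂ G, Simple V → V.character ≠ (fun _ => 1) →
      ((∑ x : G, (f x : ℂ) * (starRingEnd ℂ) (V.character x)) / (Fintype.card G : ℂ) ≠ 0) →
      (∑' s : Fin (2 * ℓ) → Fin k × Bool, ∑' x : Fin k → G,
          (V.character (FreeGroup.lift x (walkWord s))).re / (V.character 1).re) /
          (((2 * k : ℕ) : ℝ) ^ (2 * ℓ) * (Fintype.card G : ℝ) ^ k) ≤ B) :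
    (Nat.card {t : G × (Fin k → G) //
        ∀ u : FreeGroup (Fin k), u.norm ≤ ℓ →
          f (t.1 * FreeGroup.lift t.2 u) = 0} : ℝ) /
        (Fintype.card G : ℝ) ^ (k + 1) ≤
      (((∑ x : G, |f x| ^ 2) / (Fintype.card G : ℝ)) /
          ((∑ x : G, |f x|) / (Fintype.card G : ℝ)) ^ 2) * B := by
  classical
  have hN : (0 : ℝ) < Fintype.card G := Nat.cast_pos.2 Fintype.card_pos
  have hD : (0 : ℝ) < ((2 * k : ℕ) : ℝ) ^ (2 * ℓ) * (Fintype.card G : ℝ) ^ k := by positivity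
  simp only [abs_of_nonneg (hf0 _)] at hf1 ⊢
  set m := (∑ x : G, f x) / (Fintype.card G : ℝ) with hm
  have hsum : ∑ x, f x = m * Fintype.card G := by rw [hm, div_mul_cancel₀ _ hN.ne']
  set v : EuclideanSpace ℂ G := WithLp.toLp 2 fun y ↦ ((f y - m : ℝ) : ℂ) with hv
  let J := (Fin k → G) × (Fin (2 * ℓ) → Fin k × Bool)
  let a : J → G := fun j ↦ FreeGroup.lift j.1 (walkWord j.2)
  have hT : ∑ j, rightRegular G (a j) = ∑ x : Fin k → G, stepOperator x ^ (2 * ℓ) := by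
    rw [Fintype.sum_prod_type]
    exact Finset.sum_congr rfl fun x _ ↦ sum_rightRegular_walkWord x _
  have hsymm : (∑ j, rightRegular G (a j)).IsSymmetric := by
    rw [hT]
    intro u w
    simp only [LinearMap.sum_apply, sum_inner, inner_sum]
    exact Finset.sum_congr rfl fun x _ ↦ (isSymmetric_stepOperator x).pow _ u w
  have hcomm : ∀ g, Commute (rightRegular G g) (∑ j, rightRegular G (a j)) := by
    intro g
    rw [Commute, SemiconjBy, Finset.mul_sum, Finset.sum_mul]
    refine Fintype.sum_equiv
      ((Equiv.piCongrRight fun _ ↦ (MulAut.conj g).toEquiv).prodCongr (Equiv.refl _)) _ _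
      fun j ↦ ?_
    have hconj : a ((Equiv.piCongrRight fun _ ↦ (MulAut.conj g).toEquiv) j.1, j.2) =
        g * a j * g⁻¹ := lift_conj j.1 g (walkWord j.2)
    change _ =
      rightRegular G (a ((Equiv.piCongrRight fun _ ↦ (MulAut.conj g).toEquiv) j.1, j.2)) * _
    rw [hconj, ← map_mul, ← map_mul, inv_mul_cancel_right]
  have hmean : ∑ x, (f x - m) = 0 := by
    rw [Finset.sum_sub_distrib, hsum]
    simp [mul_comm]
  have hupper := inner_sum_rightRegular_le a (fun x ↦ f x - m)
    (fun x y ↦ by simp only [hfclass]) hmean hsymm hcomm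
    (B * (((2 * k : ℕ) : ℝ) ^ (2 * ℓ) * (Fintype.card G : ℝ) ^ k)) (fun V hV hVnt hVφ ↦ by
      have hV0 := sum_character_eq_zero V hVnt
      have hpair : (∑ x : G, (f x : ℂ) * (starRingEnd ℂ) (V.character x)) /
          (Fintype.card G : ℂ) ≠ 0 := by
        refine div_ne_zero (fun h0 ↦ hVφ ?_) (by exact_mod_cast hN.ne')
        have h1 := congrArg (starRingEnd ℂ) h0
        simp only [map_sum, map_mul, Complex.conj_ofReal, Complex.conj_conj, map_zero] at h1
        simp only [Complex.ofReal_sub, sub_mul, Finset.sum_sub_distrib, h1, ← Finset.mul_sum, hV0,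
          mul_zero, sub_zero]
      have h := hexp V hV hVnt hpair
      rw [div_le_iff₀ hD] at h
      simp only [tsum_fintype] at h
      rw [Fintype.sum_prod_type_right]
      exact h)
  have hsq : ∑ x, (f x - m) ^ 2 ≤ ∑ x, f x ^ 2 := by
    have : ∑ x, (f x - m) ^ 2 = ∑ x, f x ^ 2 - Fintype.card G * m ^ 2 := by
      simp only [sub_sq, Finset.sum_add_distrib, Finset.sum_sub_distrib, ← Finset.sum_mul,
        ← Finset.mul_sum, hsum, Finset.sum_const, Finset.card_univ, nsmul_eq_mul]
      ring
    rw [this]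
    have : 0 ≤ (Fintype.card G : ℝ) * m ^ 2 := by positivity
    linarith
  set P : G × (Fin k → G) → Prop := fun t ↦
    ∀ u : FreeGroup (Fin k), u.norm ≤ ℓ → f (t.1 * FreeGroup.lift t.2 u) = 0
  have hlower : (Nat.card {t // P t} : ℝ) * (((2 * k : ℕ) : ℝ) ^ (2 * ℓ) * m ^ 2) ≤
      (inner ℂ ((∑ j, rightRegular G (a j)) v) v).re := by
    rw [hT, LinearMap.sum_apply, sum_inner, Complex.re_sum]
    simp only [inner_stepOperator_pow, Complex.ofReal_re, EuclideanSpace.norm_sq_eq]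
    rw [← Fintype.sum_prod_type_right
      (f := fun t : G × (Fin k → G) ↦ ‖((stepOperator t.2 ^ ℓ) v) t.1‖ ^ 2),
      Nat.card_eq_fintype_card, Fintype.card_subtype, ← nsmul_eq_mul, ← Finset.sum_const]
    refine (Finset.sum_le_sum fun t ht ↦ ?_).trans
      (Finset.sum_le_univ_sum_of_nonneg fun t ↦ sq_nonneg _)
    rw [hv, stepOperator_pow_apply_of_forall_eq_zero f m ℓ t.1 t.2 (Finset.mem_filter.1 ht).2,
      Complex.norm_real, Real.norm_eq_abs, sq_abs]
    apply le_of_eq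
    ring
  have hfinal := hlower.trans (hupper.trans (mul_le_mul_of_nonneg_left hsq
    (mul_nonneg hB hD.le)))
  have hK : (0 : ℝ) < ((2 * k : ℕ) : ℝ) ^ (2 * ℓ) := by positivity
  rw [div_mul_eq_mul_div, div_le_div_iff₀ (by positivity) (by positivity)]
  have hcancel : (Nat.card {t // P t} : ℝ) * m ^ 2 ≤
      B * (Fintype.card G : ℝ) ^ k * ∑ x, f x ^ 2 := by
    refine le_of_mul_le_mul_left ?_ hK
    linarith
  calc _ ≤ _ := hcancel
    _ = _ := by
      field_simp
      ring
end

section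
/- There exists an absolute constant C > 0 with the following property. Let q be a prime power, n and k positive integers, and let w ∈ F_k be a nontrivial word of reduced length ℓ < n/4 which is not a proper power (i.e., w ≠ u^m for every u ∈ F_k and every integer m ≥ 2). Let v be a nonzero vector in F_q^n, and choose x_1, …, x_k independently and uniformly at random from GL_n(q). Then the probability that w(x_1, …, x_k)·v = v is at most (1/(q^n − 1)) · (1 + C·q^{2ℓ − n/2}). -/
namespace WordTrajectory

open Module Submodule

section Windows

variable {F M : Type*} [Field F] [AddCommGroup M] [Module F M]

/-- The span of the `m` consecutive terms `u p, …, u (p + m - 1)` of a sequence of vectors. -/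
def windowSpan (F : Type*) {M : Type*} [Field F] [AddCommGroup M] [Module F M]
    (u : ℕ → M) (p m : ℕ) : Submodule F M :=
  span F (u '' Set.Ico p (p + m))

lemma windowSpan_zero (u : ℕ → M) (p : ℕ) : windowSpan F u p 0 = ⊥ := by
  simp [windowSpan]

lemma windowSpan_succ (u : ℕ → M) (p m : ℕ) :
    windowSpan F u p (m + 1) = windowSpan F u p m ⊔ span F {u (p + m)} := by
  have h : Set.Ico p (p + (m + 1)) = Set.Ico p (p + m) ∪ {p + m} := by
    ext i
    simp only [Set.mem_Ico, Set.mem_union, Set.mem_singleton_iff]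
    omega
  rw [windowSpan, windowSpan, h, Set.image_union, span_union, Set.image_singleton]

lemma mem_windowSpan {u : ℕ → M} {p m i : ℕ} (h₁ : p ≤ i) (h₂ : i < p + m) :
    u i ∈ windowSpan F u p m :=
  subset_span ⟨i, ⟨h₁, h₂⟩, rfl⟩

lemma windowSpan_le_iff {u : ℕ → M} {p m : ℕ} {S : Submodule F M} :
    windowSpan F u p m ≤ S ↔ ∀ i, p ≤ i → i < p + m → u i ∈ S := by
  rw [windowSpan, span_le]
  constructor
  · exact fun h i h₁ h₂ => h ⟨i, ⟨h₁, h₂⟩, rfl⟩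
  · rintro h _ ⟨i, ⟨h₁, h₂⟩, rfl⟩
    exact h i h₁ h₂

lemma map_mem_of_mem_windowSpan {M' : Type*} [AddCommGroup M'] [Module F M']
    {u : ℕ → M} {p m : ℕ} {S : Submodule F M'} (f : M →ₗ[F] M')
    (h : ∀ i, p ≤ i → i < p + m → f (u i) ∈ S) {y : M} (hy : y ∈ windowSpan F u p m) :
    f y ∈ S :=
  (windowSpan_le_iff (S := S.comap f)).2 h hy

lemma windowSpan_congr {u u' : ℕ → M} {p m : ℕ} (h : ∀ i, p ≤ i → i < p + m → u i = u' i) :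
    windowSpan F u p m = windowSpan F u' p m := by
  rw [windowSpan, windowSpan, Set.image_congr fun i hi => h i hi.1 hi.2]

lemma finrank_windowSpan_le (u : ℕ → M) (p m : ℕ) : finrank F (windowSpan F u p m) ≤ m := by
  classical
  have h : u '' Set.Ico p (p + m) = ((Finset.Ico p (p + m)).image u : Finset M) := by simp
  rw [windowSpan, h]
  refine (finrank_span_finset_le_card _).trans (Finset.card_image_le.trans ?_)
  simp

lemma windowSpan_period {u : ℕ → M} {l : ℕ} (hl : 0 < l) (hu : ∀ i, u (i + l) = u i) (p : ℕ) :
    windowSpan F u p l = span F (Set.range u) := by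
  refine le_antisymm (span_mono (Set.image_subset_range _ _)) ?_
  have hper : Function.Periodic u l := hu
  rw [span_le]
  rintro _ ⟨i, rfl⟩
  have h := mem_windowSpan (F := F) (u := u) (p := p) (m := l) (i := p + (i + l * p - p) % l)
    (by omega) (by have := Nat.mod_lt (i + l * p - p) hl; omega)
  have hp : p ≤ i + l * p := by nlinarith
  have : u (p + (i + l * p - p) % l) = u i := by
    have e : p + (i + l * p - p) % l + l * ((i + l * p - p) / l) = i + l * p := by
      rw [add_assoc, Nat.mod_add_div]; omega
    have h1 := hper.nat_mul ((i + l * p - p) / l) (p + (i + l * p - p) % l)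
    have h2 := hper.nat_mul p i
    rw [← h1, ← h2]
    congr 1
    push_cast
    rw [mul_comm _ l, mul_comm _ l]
    exact e
  rwa [this] at h

end Windows

section Letters

variable {ι : Type*}

/-- The inverse of a letter. -/
def invLetter (a : ι × Bool) : ι × Bool := (a.1, !a.2)

lemma invLetter_invLetter (a : ι × Bool) : invLetter (invLetter a) = a := by
  simp [invLetter]

lemma invLetter_ne (a : ι × Bool) : invLetter a ≠ a := by
  obtain ⟨j, b⟩ := a
  cases b <;> simp [invLetter]

end Letters

section Trajectory

variable {ι F V : Type*} [DecidableEq ι] [Field F] [AddCommGroup V] [Module F V]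

/-- The action of a letter, given the action of the generators. -/
def letterMap (x : ι → V ≃ₗ[F] V) (a : ι × Bool) : V ≃ₗ[F] V :=
  bif a.2 then x a.1 else (x a.1)⁻¹

/-- The `i`-th step `v i ↦ v (i + 1)` of a trajectory, recorded as a vector of the domain of the
generator it involves. -/
def edge (s : ℕ → ι × Bool) (v : ℕ → V) (i : ℕ) : ι → V :=
  Pi.single (s i).1 (bif (s i).2 then v i else v (i + 1))

/-- The image, under the letter `a`, of a vector of the domains of the generators. -/
def target (x : ι → V ≃ₗ[F] V) (a : ι × Bool) : (ι → V) →ₗ[F] V :=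
  bif a.2 then (x a.1).toLinearMap ∘ₗ LinearMap.proj a.1 else LinearMap.proj a.1

/-- The vector which the `i`-th step shows to be in the image of the letter `a`. -/
def knownImage (s : ℕ → ι × Bool) (v : ℕ → V) (a : ι × Bool) (i : ℕ) : V :=
  if a = s i then v (i + 1) else if a = invLetter (s i) then v i else 0

/-- The step at time `m` of the trajectory started at time `p` is not determined by the earlier
ones, but ends in the span of the vectors already visited. -/
def Coincidence (F : Type*) {V : Type*} [Field F] [AddCommGroup V] [Module F V]
    (s : ℕ → ι × Bool) (v : ℕ → V) (p m : ℕ) : Prop :=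
  edge s v (p + m) ∉ windowSpan F (edge s v) p m ∧ v (p + m + 1) ∈ windowSpan F v p (m + 1)

variable {x : ι → V ≃ₗ[F] V} {s : ℕ → ι × Bool} {v : ℕ → V}

lemma target_edge (hv : ∀ i, v (i + 1) = letterMap x (s i) (v i)) (a : ι × Bool) (i : ℕ) :
    target x a (edge s v i) = knownImage s v a i := by
  have h := hv i
  obtain ⟨j, b⟩ := a
  rcases hs : s i with ⟨j', b'⟩
  rw [hs] at h
  by_cases hj : j = j'
  · subst hj
    cases b <;> cases b' <;>
      simp_all [target, edge, knownImage, invLetter, letterMap, LinearEquiv.coe_inv]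
  · cases b <;> cases b' <;> simp [target, edge, knownImage, invLetter, hs, hj]

lemma edge_mem_of_knownImage (hv : ∀ i, v (i + 1) = letterMap x (s i) (v i)) {p m : ℕ}
    (h : v (p + m + 1) ∈ windowSpan F (knownImage s v (s (p + m))) p m) :
    edge s v (p + m) ∈ windowSpan F (edge s v) p m := by
  let f (a : ι × Bool) : V →ₗ[F] (ι → V) := LinearMap.single F (fun _ : ι => V) a.1 ∘ₗ
    (bif a.2 then (x a.1).symm.toLinearMap else LinearMap.id)
  have hf : ∀ (a : ι × Bool) (i : ℕ), a = s i ∨ a = invLetter (s i) →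
      f a (knownImage s v a i) = edge s v i := by
    rintro ⟨j, b⟩ i ha
    have h := hv i
    rcases hs : s i with ⟨j', b'⟩
    rw [hs] at h ha
    have hj : j = j' := by rcases ha with ha | ha <;> exact congrArg Prod.fst ha
    subst hj
    cases b <;> cases b' <;>
      simp_all [f, edge, knownImage, invLetter, letterMap, LinearEquiv.coe_inv]
  have h₁ := hf (s (p + m)) (p + m) (Or.inl rfl)
  rw [knownImage, if_pos rfl] at h₁
  rw [← h₁]
  refine map_mem_of_mem_windowSpan (f (s (p + m))) (fun i hi₁ hi₂ => ?_) h
  by_cases ha : s (p + m) = s i ∨ s (p + m) = invLetter (s i)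
  · rw [hf _ _ ha]
    exact mem_windowSpan hi₁ hi₂
  · push Not at ha
    rw [knownImage, if_neg ha.1, if_neg ha.2, map_zero]
    exact zero_mem _

lemma mem_windowSpan_of_edge_mem (hv : ∀ i, v (i + 1) = letterMap x (s i) (v i)) {p m : ℕ}
    (h : edge s v (p + m) ∈ windowSpan F (edge s v) p m) :
    v (p + m + 1) ∈ windowSpan F v p (m + 1) := by
  have h₁ := target_edge hv (s (p + m)) (p + m)
  rw [knownImage, if_pos rfl] at h₁
  rw [← h₁]
  refine map_mem_of_mem_windowSpan _ (fun i hi₁ hi₂ => ?_) h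
  rw [target_edge hv, knownImage]
  split_ifs
  · exact mem_windowSpan (by omega) (by omega)
  · exact mem_windowSpan (by omega) (by omega)
  · exact zero_mem _

lemma target_invLetter_edge (hv : ∀ i, v (i + 1) = letterMap x (s i) (v i)) (i : ℕ) :
    target x (invLetter (s i)) (edge s v i) = v i := by
  rw [target_edge hv, knownImage, if_neg (invLetter_ne _), if_pos rfl]

lemma mem_windowSpan_shift (hv : ∀ i, v (i + 1) = letterMap x (s i) (v i))
    (hs : ∀ i, s (i + 1) ≠ invLetter (s i)) {p m : ℕ}
    (h : edge s v (p + m) ∈ windowSpan F (edge s v) p m) {p' m' : ℕ} (hpm : p' + m' = p + m)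
    (hp : p' ≤ p + 1) (hp' : s p = s (p + m) → p' ≤ p) :
    v (p + m) ∈ windowSpan F v p' m' := by
  rw [← target_invLetter_edge hv (p + m)]
  refine map_mem_of_mem_windowSpan _ (fun i hi₁ hi₂ => ?_) h
  rw [target_edge hv, knownImage]
  split_ifs with h₁ h₂
  · have : i + 1 ≠ p + m := fun he => hs i (by
      rw [he, ← h₁, invLetter_invLetter])
    exact mem_windowSpan (by omega) (by omega)
  · have h₃ : s i = s (p + m) := by
      rw [← invLetter_invLetter (s i), ← h₂, invLetter_invLetter]
    refine mem_windowSpan ?_ (by omega)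
    rcases hi₁.eq_or_lt with rfl | hlt
    · exact hp' h₃
    · omega
  · exact zero_mem _

lemma mem_windowSpan_of_edge_mem_of_reduced (hv : ∀ i, v (i + 1) = letterMap x (s i) (v i))
    (hs : ∀ i, s (i + 1) ≠ invLetter (s i)) {p m : ℕ}
    (h : edge s v (p + m) ∈ windowSpan F (edge s v) p m) :
    v (p + m) ∈ windowSpan F v p m :=
  mem_windowSpan_shift hv hs h rfl (by omega) fun _ => le_rfl

section Count

open Classical in
lemma finrank_windowSpan_succ {M : Type*} [AddCommGroup M] [Module F M] [FiniteDimensional F M]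
    (u : ℕ → M) (p m : ℕ) :
    finrank F (windowSpan F u p (m + 1)) =
      finrank F (windowSpan F u p m) + if u (p + m) ∈ windowSpan F u p m then 0 else 1 := by
  rw [windowSpan_succ]
  split_ifs with h
  · rw [sup_eq_left.2 ((span_singleton_le_iff_mem _ _).2 h), add_zero]
  · exact finrank_sup_span_singleton h

variable [FiniteDimensional F V]

open Classical in
lemma finrank_edges_eq [Fintype ι] (hv : ∀ i, v (i + 1) = letterMap x (s i) (v i)) {p : ℕ}
    (hp : v p ≠ 0)
    (m : ℕ) :
    finrank F (windowSpan F (edge s v) p m) + 1 =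
      finrank F (windowSpan F v p (m + 1)) +
        ((Finset.range m).filter fun i => Coincidence F s v p i).card := by
  induction m with
  | zero => rw [finrank_windowSpan_succ, windowSpan_zero, windowSpan_zero]; simp [hp]
  | succ m ih =>
    rw [finrank_windowSpan_succ (F := F) (edge s v), finrank_windowSpan_succ (F := F) v p (m + 1),
      Finset.range_add_one, Finset.filter_insert]
    have h₁ := mem_windowSpan_of_edge_mem hv (p := p) (m := m)
    by_cases he : edge s v (p + m) ∈ windowSpan F (edge s v) p m
    · have h₂ : ¬ Coincidence F s v p m := fun h => h.1 he
      have h₃ := h₁ he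
      rw [add_assoc] at h₃
      simp only [if_pos he, if_neg h₂, if_pos h₃]
      omega
    · by_cases hw : v (p + m + 1) ∈ windowSpan F v p (m + 1)
      · have h₂ : Coincidence F s v p m := ⟨he, hw⟩
        rw [add_assoc] at hw
        simp only [if_neg he, if_pos h₂, if_pos hw]
        rw [Finset.card_insert_of_notMem (by simp)]
        omega
      · have h₂ : ¬ Coincidence F s v p m := fun h => hw h.2
        rw [add_assoc] at hw
        simp only [if_neg he, if_neg h₂, if_neg hw]
        omega

open Classical in
/-- The shape of a closed trajectory with at most one coincidence. -/
lemma exists_first_return (hv : ∀ i, v (i + 1) = letterMap x (s i) (v i))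
    (hs : ∀ i, s (i + 1) ≠ invLetter (s i)) {l : ℕ} {p : ℕ}
    (hp : v p ≠ 0) (hclose : v (p + l) = v p) (hl : 0 < l)
    (hc : ((Finset.range l).filter fun i => Coincidence F s v p i).card ≤ 1) :
    finrank F (windowSpan F v p l) ≤ l ∧
      (∀ j < finrank F (windowSpan F v p l), v (p + j) ∉ windowSpan F v p j) ∧
      (finrank F (windowSpan F v p l) < l →
        edge s v (p + finrank F (windowSpan F v p l)) ∈
          windowSpan F (edge s v) p (finrank F (windowSpan F v p l))) := by
  have hlast : v (p + l) ∈ windowSpan F v p l := by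
    rw [hclose]; exact mem_windowSpan le_rfl (by omega)
  have hex : ∃ t, v (p + t) ∈ windowSpan F v p t := ⟨l, hlast⟩
  obtain ⟨t, ht, hmin⟩ : ∃ t, v (p + t) ∈ windowSpan F v p t ∧
      ∀ j < t, v (p + j) ∉ windowSpan F v p j :=
    ⟨Nat.find hex, Nat.find_spec hex, fun j hj => Nat.find_min hex hj⟩
  have htl : t ≤ l := by
    by_contra h
    exact hmin l (by omega) hlast
  have ht0 : t ≠ 0 := by
    rintro rfl
    rw [windowSpan_zero, mem_bot] at ht
    exact hp ht
  have hfree : ∀ j, v (p + j) ∉ windowSpan F v p j →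
      edge s v (p + j) ∉ windowSpan F (edge s v) p j :=
    fun j => mt (mem_windowSpan_of_edge_mem_of_reduced hv hs)
  have hco : Coincidence F s v p (t - 1) := by
    refine ⟨hfree _ (hmin _ (by omega)), ?_⟩
    rw [add_assoc, Nat.sub_add_cancel (by omega)]
    exact ht
  have hno : ∀ m, t ≤ m → m < l → ¬ Coincidence F s v p m := by
    intro m hm hml h
    have := Finset.card_le_one.1 hc m (by simp [hml, h]) (t - 1)
      (by simp only [Finset.mem_filter, Finset.mem_range]; exact ⟨by omega, hco⟩)
    omega
  have hin : ∀ m, t ≤ m → m ≤ l → v (p + m) ∈ windowSpan F v p m := by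
    intro m hm hml
    by_contra hout
    have : ∀ j, m + j ≤ l → v (p + (m + j)) ∉ windowSpan F v p (m + j) := by
      intro j
      induction j with
      | zero => exact fun _ => hout
      | succ j ih =>
        intro hj hmem
        exact hno (m + j) (by omega) (by omega) ⟨hfree _ (ih (by omega)), hmem⟩
    have h := this (l - m) (by omega)
    rw [Nat.add_sub_cancel' hml] at h
    exact h hlast
  have hstab : ∀ j, t + j ≤ l → windowSpan F v p (t + j) = windowSpan F v p t := by
    intro j
    induction j with
    | zero => exact fun _ => rfl
    | succ j ih =>
      intro hj
      rw [← add_assoc, windowSpan_succ, sup_eq_left.2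
        ((span_singleton_le_iff_mem _ _).2 (hin (t + j) (by omega) (by omega))), ih (by omega)]
  have hrank : ∀ j ≤ t, finrank F (windowSpan F v p j) = j := by
    intro j
    induction j with
    | zero => simp [windowSpan_zero]
    | succ j ih =>
      intro hj
      rw [finrank_windowSpan_succ, ih (by omega), if_neg (hmin j (by omega))]
  have hd : finrank F (windowSpan F v p l) = t := by
    have h := hstab (l - t) (by omega)
    rw [Nat.add_sub_cancel' htl] at h
    rw [h, hrank t le_rfl]
  rw [hd]
  refine ⟨htl, hmin, fun hlt => ?_⟩
  by_contra he
  exact hno t le_rfl hlt ⟨he, hin (t + 1) (by omega) hlt⟩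

open Classical in
/-- In a closed trajectory with at most one coincidence, either the vectors visited before closing
are linearly independent or the sequence of letters has a smaller period. -/
lemma independent_or_periodic [Fintype ι] (hv : ∀ i, v (i + 1) = letterMap x (s i) (v i))
    (hs : ∀ i, s (i + 1) ≠ invLetter (s i)) {l : ℕ} (hl : 0 < l)
    (hsl : ∀ i, s (i + l) = s i) (hvl : ∀ i, v (i + l) = v i) (hne : ∀ i, v i ≠ 0)
    (hc : ((Finset.range l).filter fun i => Coincidence F s v 0 i).card ≤ 1) :
    (∀ j < l, v j ∉ windowSpan F v 0 j) ∨ ∃ d, 0 < d ∧ d < l ∧ ∀ i, s (i + d) = s i := by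
  have hel : ∀ i, edge s v (i + l) = edge s v i := fun i => by
    rw [edge, edge, hsl, hvl, add_right_comm, hvl]
  have hcp : ∀ p, ((Finset.range l).filter fun i => Coincidence F s v p i).card ≤ 1 := by
    intro p
    have h₀ := finrank_edges_eq hv (hne 0) l
    have h₁ := finrank_edges_eq hv (hne p) l
    have hw : ∀ p, windowSpan F v p (l + 1) = span F (Set.range v) := fun p => by
      rw [windowSpan_succ, windowSpan_period hl hvl, sup_eq_left, span_singleton_le_iff_mem]
      exact subset_span ⟨_, rfl⟩
    rw [windowSpan_period hl hel, hw] at h₀ h₁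
    omega
  have key := fun p => exists_first_return hv hs (hne p) (hvl p) hl (hcp p)
  set d := finrank F (span F (Set.range v))
  have hper : ∀ p, finrank F (windowSpan F v p l) = d := fun p => by
    rw [windowSpan_period hl hvl]
  simp only [hper] at key
  have hd0 : 0 < d := by
    rw [Nat.pos_iff_ne_zero]
    intro hd
    have : v 0 ∈ span F (Set.range v) := subset_span ⟨0, rfl⟩
    rw [finrank_eq_zero.1 hd, mem_bot] at this
    exact hne 0 this
  rcases (key 0).1.eq_or_lt with hdl | hdl
  · left
    have := (key 0).2.1
    simpa [hdl] using this
  · right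
    refine ⟨d, hd0, hdl, fun p => ?_⟩
    by_contra hsp
    have h := mem_windowSpan_shift hv hs ((key p).2.2 hdl) (p' := p + 1) (m' := d - 1)
      (by omega) le_rfl (fun h => absurd h.symm hsp)
    refine (key (p + 1)).2.1 (d - 1) (by omega) ?_
    rwa [show p + 1 + (d - 1) = p + d by omega]

end Count

end Trajectory

section Fixing

variable {F V : Type*} [Field F] [AddCommGroup V] [Module F V]

/-- The pointwise stabilizer of a subspace is transitive on the vectors outside of it. -/
lemma exists_linearEquiv_fixing (R : Submodule F V) {b b' : V} (hb : b ∉ R) (hb' : b' ∉ R) :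
    ∃ h : V ≃ₗ[F] V, (∀ r ∈ R, h r = r) ∧ h b = b' := by
  have hdual : ∀ c ∉ R, ∃ f : V →ₗ[F] F, (∀ r ∈ R, f r = 0) ∧ f c ≠ 0 := by
    intro c hc
    obtain ⟨f, hf, hR⟩ := Submodule.exists_dual_map_eq_bot_of_notMem hc inferInstance
    refine ⟨f, fun r hr => ?_, hf⟩
    have : f r ∈ R.map f := mem_map_of_mem hr
    rwa [hR, mem_bot] at this
  obtain ⟨f, hfR, hfb, hfb'⟩ : ∃ f : V →ₗ[F] F, (∀ r ∈ R, f r = 0) ∧ f b ≠ 0 ∧ f b' ≠ 0 := by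
    obtain ⟨f, hfR, hf⟩ := hdual b hb
    obtain ⟨g, hgR, hg⟩ := hdual b' hb'
    by_cases h₁ : f b' = 0
    · by_cases h₂ : g b = 0
      · exact ⟨f + g, fun r hr => by simp [hfR r hr, hgR r hr], by simp [h₂, hf], by simp [h₁, hg]⟩
      · exact ⟨g, hgR, h₂, hg⟩
    · exact ⟨f, hfR, hf, h₁⟩
  let t (c c' : V) : V →ₗ[F] V := LinearMap.id + ((f c)⁻¹ • f).smulRight (c' - c)
  have ht : ∀ c c' y, t c c' y = y + ((f c)⁻¹ * f y) • (c' - c) := fun c c' y => by simp [t]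
  have hinv : ∀ c c', f c ≠ 0 → f c' ≠ 0 → t c' c ∘ₗ t c c' = LinearMap.id := by
    intro c c' hc hc'
    ext y
    have : (f c')⁻¹ * (f y + (f c)⁻¹ * f y * (f c' - f c)) = (f c)⁻¹ * f y := by
      field_simp
      ring
    simp only [LinearMap.comp_apply, ht, map_add, map_smul, map_sub, smul_eq_mul, this,
      LinearMap.id_apply]
    module
  refine ⟨LinearEquiv.ofLinearMap (t b b') (t b' b) (hinv _ _ hfb' hfb) (hinv _ _ hfb hfb'), ?_, ?_⟩
  · intro r hr
    simp [ht, hfR r hr]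
  · simp [ht, hfb]

end Fixing

section Twist

variable {ι F V : Type*} [DecidableEq ι] [Field F] [AddCommGroup V] [Module F V]

/-- The trajectory of a vector under a sequence of letters. -/
def traj (s : ℕ → ι × Bool) (v₀ : V) (x : ι → V ≃ₗ[F] V) : ℕ → V
  | 0 => v₀
  | i + 1 => letterMap x (s i) (traj s v₀ x i)

/-- Modify the action of the generators so that the action of the letter `a` is followed by `h`. -/
def twist (h : V ≃ₗ[F] V) (a : ι × Bool) (x : ι → V ≃ₗ[F] V) : ι → V ≃ₗ[F] V :=
  Function.update x a.1 (bif a.2 then h * x a.1 else x a.1 * h⁻¹)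

lemma twist_injective (h : V ≃ₗ[F] V) (a : ι × Bool) : Function.Injective (twist h a) := by
  intro x y hxy
  funext j
  have hj := congrFun hxy j
  by_cases hja : j = a.1
  · subst hja
    rcases ha : a.2 <;> simpa [twist, ha] using hj
  · simpa [twist, hja] using hj

lemma letterMap_twist_self (h : V ≃ₗ[F] V) (a : ι × Bool) (x : ι → V ≃ₗ[F] V) (y : V) :
    letterMap (twist h a x) a y = h (letterMap x a y) := by
  obtain ⟨j, b⟩ := a
  cases b <;> simp [letterMap, twist]

lemma letterMap_twist (h : V ≃ₗ[F] V) (a : ι × Bool) (x : ι → V ≃ₗ[F] V) (c : ι × Bool) {y : V}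
    (h₁ : a = c → h (letterMap x c y) = letterMap x c y) (h₂ : a = invLetter c → h y = y) :
    letterMap (twist h a x) c y = letterMap x c y := by
  by_cases hc : a = c
  · subst hc
    rw [letterMap_twist_self, h₁ rfl]
  · by_cases hc' : a = invLetter c
    · have hy : h⁻¹ y = y := by
        have := h₂ hc'
        rw [LinearEquiv.coe_inv, LinearEquiv.symm_apply_eq, this]
      obtain ⟨j, b⟩ := c
      subst hc'
      cases b <;> simp_all [letterMap, twist, invLetter]
    · have : c.1 ≠ a.1 := by
        obtain ⟨j, b⟩ := c
        obtain ⟨j', b'⟩ := a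
        rintro rfl
        cases b <;> cases b' <;> simp_all [invLetter]
      simp [letterMap, twist, this]

variable {s : ℕ → ι × Bool} {v₀ : V} {x : ι → V ≃ₗ[F] V} {h : V ≃ₗ[F] V} {m : ℕ}

lemma traj_twist
    (hh : ∀ i < m, h (knownImage s (traj s v₀ x) (s m) i) = knownImage s (traj s v₀ x) (s m) i)
    {i : ℕ} (hi : i ≤ m) : traj s v₀ (twist h (s m) x) i = traj s v₀ x i := by
  induction i with
  | zero => rfl
  | succ i ih =>
    have h' := hh i (by omega)
    rw [traj, ih (by omega)]
    refine letterMap_twist _ _ _ _ (fun hc => ?_) (fun hc => ?_)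
    · rw [knownImage, if_pos hc] at h'
      exact h'
    · rw [knownImage, if_neg (by rw [hc]; exact invLetter_ne _), if_pos hc] at h'
      exact h'

lemma traj_twist_succ
    (hh : ∀ i < m, h (knownImage s (traj s v₀ x) (s m) i) = knownImage s (traj s v₀ x) (s m) i) :
    traj s v₀ (twist h (s m) x) (m + 1) = h (traj s v₀ x (m + 1)) := by
  rw [traj, traj_twist hh le_rfl, letterMap_twist_self, traj]

lemma knownImage_congr {u u' : ℕ → V} {i : ℕ} (h₁ : u i = u' i) (h₂ : u (i + 1) = u' (i + 1))
    (a : ι × Bool) : knownImage s u a i = knownImage s u' a i := by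
  rw [knownImage, knownImage, h₁, h₂]

lemma edge_congr {u u' : ℕ → V} {i : ℕ} (h₁ : u i = u' i) (h₂ : u (i + 1) = u' (i + 1)) :
    edge s u i = edge s u' i := by
  rw [edge, edge, h₁, h₂]

lemma Coincidence.congr {u u' : ℕ → V} (hu : ∀ i ≤ m + 1, u i = u' i)
    (hc : Coincidence F s u 0 m) : Coincidence F s u' 0 m := by
  have he : ∀ i ≤ m, edge s u i = edge s u' i := fun i hi =>
    edge_congr (hu i (by omega)) (hu _ (by omega))
  rw [Coincidence, zero_add] at hc ⊢
  rw [← he m le_rfl, ← hu (m + 1) le_rfl,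
    ← windowSpan_congr (u := edge s u) (fun i _ hi => he i (by omega)),
    ← windowSpan_congr (u := u) (fun i _ hi => hu i (by omega))]
  exact hc

lemma card_submodule_le [Fintype F] [Fintype V] (R : Submodule F V) [Fintype R] {d : ℕ}
    (hd : finrank F R ≤ d) : Fintype.card R ≤ Fintype.card F ^ d := by
  rw [Module.card_eq_pow_finrank (K := F)]
  exact Nat.pow_le_pow_right Fintype.card_pos hd

open Classical in
/-- Conditionally on the first `m` steps, a free step is close to uniformly distributed. -/
lemma card_free_step_le [Fintype ι] [Fintype F] [Fintype V] [Fintype (V ≃ₗ[F] V)]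
    (s : ℕ → ι × Bool) (v₀ : V) (m β : ℕ)
    (P : (ℕ → V) → Prop) (hP : ∀ u u', (∀ i ≤ m, u i = u' i) → P u → P u')
    (B : (ℕ → V) → Finset V) (hB : ∀ u u', (∀ i ≤ m, u i = u' i) → B u = B u')
    (hβ : ∀ u, (B u).card ≤ β) :
    (Fintype.card V - Fintype.card F ^ m) *
      (Finset.univ.filter fun x : ι → V ≃ₗ[F] V => P (traj s v₀ x) ∧
        edge s (traj s v₀ x) m ∉ windowSpan F (edge s (traj s v₀ x)) 0 m ∧
        traj s v₀ x (m + 1) ∈ B (traj s v₀ x)).card ≤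
    β * (Finset.univ.filter fun x : ι → V ≃ₗ[F] V => P (traj s v₀ x)).card := by
  set A := Finset.univ.filter fun x : ι → V ≃ₗ[F] V => P (traj s v₀ x) ∧
        edge s (traj s v₀ x) m ∉ windowSpan F (edge s (traj s v₀ x)) 0 m ∧
        traj s v₀ x (m + 1) ∈ B (traj s v₀ x)
  set Q := Finset.univ.filter fun x : ι → V ≃ₗ[F] V => P (traj s v₀ x)
  let R (x : ι → V ≃ₗ[F] V) : Submodule F V :=
    windowSpan F (knownImage s (traj s v₀ x) (s m)) 0 m
  have hA : ∀ x ∈ A, P (traj s v₀ x) ∧ traj s v₀ x (m + 1) ∉ R x ∧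
      traj s v₀ x (m + 1) ∈ B (traj s v₀ x) := by
    intro x hx
    obtain ⟨h₁, h₂, h₃⟩ := (Finset.mem_filter.1 hx).2
    refine ⟨h₁, fun hR => h₂ ?_, h₃⟩
    have := edge_mem_of_knownImage (F := F) (x := x) (s := s) (v := traj s v₀ x)
      (fun i => rfl) (p := 0) (m := m)
    simp only [zero_add] at this
    exact this hR
  choose! h hfix hmap using fun (R : Submodule F V) (b b' : V) (hb : b ∉ R ∧ b' ∉ R) =>
    exists_linearEquiv_fixing R hb.1 hb.2
  have hfix' : ∀ x b b', b ∉ R x → b' ∉ R x → ∀ i < m,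
      h (R x) b b' (knownImage s (traj s v₀ x) (s m) i) =
        knownImage s (traj s v₀ x) (s m) i := fun x b b' hb hb' i hi =>
    hfix _ _ _ ⟨hb, hb'⟩ _ (mem_windowSpan (Nat.zero_le _) (by omega))
  let S := A.sigma fun x => Finset.univ.filter fun b' => b' ∉ R x
  let T := Q.sigma fun x => B (traj s v₀ x)
  let Φ (p : Σ _ : ι → V ≃ₗ[F] V, V) : Σ _ : ι → V ≃ₗ[F] V, V :=
    ⟨twist (h (R p.1) (traj s v₀ p.1 (m + 1)) p.2) (s m) p.1, traj s v₀ p.1 (m + 1)⟩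
  have hST : S.card ≤ T.card := by
    refine Finset.card_le_card_of_injOn Φ ?_ ?_
    · rintro ⟨x, b'⟩ hx
      obtain ⟨hxA, hb'⟩ := Finset.mem_sigma.1 (Finset.mem_coe.1 hx)
      obtain ⟨h₁, h₂, h₃⟩ := hA x hxA
      have hb'' : b' ∉ R x := (Finset.mem_filter.1 hb').2
      have ht : ∀ i ≤ m, traj s v₀ x i = traj s v₀ (Φ ⟨x, b'⟩).1 i := fun i hi =>
        (traj_twist (hfix' x _ _ h₂ hb'') hi).symm
      refine Finset.mem_coe.2 (Finset.mem_sigma.2 ⟨?_, ?_⟩)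
      · exact Finset.mem_filter.2 ⟨Finset.mem_univ _, hP _ _ ht h₁⟩
      · rw [← hB _ _ ht]
        exact h₃
    · rintro ⟨x, b⟩ hx ⟨y, c⟩ hy hxy
      obtain ⟨hxA, hb⟩ := Finset.mem_sigma.1 (Finset.mem_coe.1 hx)
      obtain ⟨hyA, hc⟩ := Finset.mem_sigma.1 (Finset.mem_coe.1 hy)
      have hb' : b ∉ R x := (Finset.mem_filter.1 hb).2
      have hc' : c ∉ R y := (Finset.mem_filter.1 hc).2
      have hxR := (hA x hxA).2.1
      have hyR := (hA y hyA).2.1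
      have h₁ : twist (h (R x) (traj s v₀ x (m + 1)) b) (s m) x =
          twist (h (R y) (traj s v₀ y (m + 1)) c) (s m) y := congrArg Sigma.fst hxy
      have h₂ : traj s v₀ x (m + 1) = traj s v₀ y (m + 1) :=
        congrArg (fun p : Σ _ : ι → V ≃ₗ[F] V, V => p.2) hxy
      have ht : ∀ i ≤ m, traj s v₀ x i = traj s v₀ y i := fun i hi => by
        rw [← traj_twist (hfix' x _ _ hxR hb') hi, h₁, traj_twist (hfix' y _ _ hyR hc') hi]
      have hR : R x = R y := windowSpan_congr fun i _ hi =>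
        knownImage_congr (ht i (by omega)) (ht _ (by omega)) _
      have hbc : b = c := by
        rw [← hmap _ _ _ ⟨hxR, hb'⟩, ← traj_twist_succ (hfix' x _ _ hxR hb'), h₁,
          traj_twist_succ (hfix' y _ _ hyR hc'), hmap _ _ _ ⟨hyR, hc'⟩]
      rw [hR, h₂, hbc] at h₁
      rw [twist_injective _ _ h₁, hbc]
  calc (Fintype.card V - Fintype.card F ^ m) * A.card
      ≤ S.card := by
        rw [Finset.card_sigma, mul_comm, ← smul_eq_mul]
        refine Finset.card_nsmul_le_sum _ _ _ fun x _ => ?_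
        have h₁ : (Finset.univ.filter fun b' => b' ∉ R x).card =
            Fintype.card V - Fintype.card (R x) := by
          rw [Finset.filter_not, Finset.card_sdiff_of_subset (Finset.filter_subset _ _),
            Finset.card_univ, Fintype.card_subtype]
        rw [h₁]
        have := card_submodule_le (R x) (finrank_windowSpan_le _ _ _)
        omega
    _ ≤ T.card := hST
    _ ≤ β * Q.card := by
        rw [Finset.card_sigma, mul_comm, ← smul_eq_mul]
        exact Finset.sum_le_card_nsmul _ _ _ fun x _ => hβ _

end Twist

section Words

variable {ι : Type*}

/-- The product of the first letters of a sequence, the later letters standing on the left. -/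
def wordOf (s : ℕ → ι × Bool) : ℕ → FreeGroup ι
  | 0 => 1
  | i + 1 => FreeGroup.mk [s i] * wordOf s i

lemma wordOf_add {s : ℕ → ι × Bool} {d : ℕ} (hs : ∀ i, s (i + d) = s i) (i : ℕ) :
    wordOf s (i + d) = wordOf s i * wordOf s d := by
  induction i with
  | zero => simp [wordOf]
  | succ i ih => rw [add_right_comm, wordOf, ih, hs, wordOf, mul_assoc]

lemma wordOf_mul {s : ℕ → ι × Bool} {d : ℕ} (hs : ∀ i, s (i + d) = s i) (a : ℕ) :
    wordOf s (a * d) = wordOf s d ^ a := by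
  induction a with
  | zero => simp [wordOf]
  | succ a ih => rw [add_one_mul, wordOf_add hs, ih, pow_succ]

lemma wordOf_eq_pow {s : ℕ → ι × Bool} {d l : ℕ} (hd : 0 < d) (hdl : d < l)
    (hsd : ∀ i, s (i + d) = s i) (hsl : ∀ i, s (i + l) = s i) :
    ∃ (u : FreeGroup ι) (m : ℕ), 2 ≤ m ∧ wordOf s l = u ^ m := by
  have hg : Nat.gcd d l < l := (Nat.gcd_le_left l hd).trans_lt hdl
  obtain ⟨a, -, ha⟩ := Nat.exists_mul_mod_eq_gcd hg
  have hsg : ∀ i, s (i + Nat.gcd d l) = s i := by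
    intro i
    have h₁ := Function.Periodic.nat_mul (f := s) hsl (d * a / l) (i + Nat.gcd d l)
    have h₂ := Function.Periodic.nat_mul (f := s) hsd a i
    rw [← h₁, ← h₂, ← ha, add_assoc]
    congr 2
    push_cast
    rw [mul_comm _ l, mul_comm a d]
    exact Nat.mod_add_div _ _
  obtain ⟨m, hm⟩ := Nat.gcd_dvd_right d l
  refine ⟨wordOf s (Nat.gcd d l), m, ?_, ?_⟩
  · by_contra h
    have : m ≤ 1 := by omega
    nlinarith
  · rw [← wordOf_mul hsg, mul_comm m, ← hm]

/-- A cyclically reduced word, read from the right and repeated periodically. -/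
lemma exists_sequence_of_isCyclicallyReduced {L : List (ι × Bool)} (hL : L ≠ [])
    (hc : FreeGroup.IsCyclicallyReduced L) :
    ∃ s : ℕ → ι × Bool, (∀ i, s (i + L.length) = s i) ∧ (∀ i, s (i + 1) ≠ invLetter (s i)) ∧
      wordOf s L.length = FreeGroup.mk L := by
  have hl : 0 < L.length := List.length_pos_iff.2 hL
  have hb : ∀ i, L.length - 1 - i % L.length < L.length := fun i => by omega
  refine ⟨fun i => L[L.length - 1 - i % L.length]'(hb i), fun i => by simp, fun i => ?_, ?_⟩
  · have hne : ∀ a b : ι × Bool, (a.1 = b.1 → a.2 = b.2) → a ≠ invLetter b := by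
      rintro ⟨j, c⟩ ⟨j', c'⟩ h h'
      cases c <;> cases c' <;> simp_all [invLetter]
    apply hne
    have hi := Nat.mod_lt i hl
    by_cases hlast : i % L.length = L.length - 1
    · have h₁ : (i + 1) % L.length = 0 := by
        rw [← Nat.mod_add_mod, hlast, Nat.sub_add_cancel hl, Nat.mod_self]
      simp only [h₁, hlast]
      refine hc.2 _ ?_ _ ?_
      · simp [List.getLast?_eq_getElem?]
      · simp [List.head?_eq_getElem?]
    · have h₁ : (i + 1) % L.length = i % L.length + 1 := by
        rw [← Nat.mod_add_mod, Nat.mod_eq_of_lt (by omega)]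
      simp only [h₁]
      have := List.isChain_iff_getElem.1 hc.1 (L.length - 1 - (i % L.length + 1)) (by omega)
      simpa [show L.length - 1 - (i % L.length + 1) + 1 = L.length - 1 - i % L.length by omega]
        using this
  · have : ∀ i ≤ L.length, wordOf (fun i => L[L.length - 1 - i % L.length]'(hb i)) i =
        FreeGroup.mk (L.drop (L.length - i)) := by
      intro i
      induction i with
      | zero => simp [wordOf, FreeGroup.one_eq_mk]
      | succ i ih =>
        intro hi
        rw [wordOf, ih (by omega), FreeGroup.mul_mk]
        congr 1
        rw [List.drop_eq_getElem_cons (i := L.length - (i + 1)) (by omega)]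
        simp only [List.singleton_append, Nat.mod_eq_of_lt (show i < L.length by omega)]
        congr 2 <;> omega
    simpa using this L.length le_rfl

lemma exists_conj_isCyclicallyReduced [DecidableEq ι] (w : FreeGroup ι) :
    ∃ (g : FreeGroup ι) (L : List (ι × Bool)), FreeGroup.IsCyclicallyReduced L ∧
      L.length ≤ w.norm ∧ w = g * FreeGroup.mk L * g⁻¹ := by
  have h := FreeGroup.reduceCyclically.conj_conjugator_reduceCyclically w.toWord
  refine ⟨FreeGroup.mk (FreeGroup.reduceCyclically.conjugator w.toWord),
    FreeGroup.reduceCyclically w.toWord,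
    FreeGroup.reduceCyclically.isCyclicallyReduced FreeGroup.isReduced_toWord, ?_, ?_⟩
  · have := congrArg List.length h
    simp only [List.length_append] at this
    rw [FreeGroup.norm]
    omega
  · rw [FreeGroup.inv_mk, FreeGroup.mul_mk, FreeGroup.mul_mk, h, FreeGroup.mk_toWord]

end Words

section Counting

variable {ι F V : Type*} [Field F] [AddCommGroup V] [Module F V]

lemma lift_mk_singleton (x : ι → V ≃ₗ[F] V) (a : ι × Bool) :
    FreeGroup.lift x (FreeGroup.mk [a]) = letterMap x a := by
  obtain ⟨j, b⟩ := a
  cases b <;> simp [letterMap]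

lemma lift_wordOf (s : ℕ → ι × Bool) (x : ι → V ≃ₗ[F] V) (v₀ : V) (i : ℕ) :
    FreeGroup.lift x (wordOf s i) v₀ = traj s v₀ x i := by
  induction i with
  | zero => simp [wordOf, traj]
  | succ i ih => rw [wordOf, map_mul, lift_mk_singleton, LinearEquiv.mul_apply, ih, traj]

/-- The number of substitutions for which the word `w` fixes the vector `v`. -/
noncomputable def fixCount (F : Type*) [Field F] [Module F V] (w : FreeGroup ι) (v : V) : ℕ :=
  Nat.card {x : ι → V ≃ₗ[F] V // FreeGroup.lift x w v = v}

lemma lift_conj {G : Type*} [Group G] (x : ι → G) (h : G) (w : FreeGroup ι) :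
    FreeGroup.lift (fun j => h * x j * h⁻¹) w = h * FreeGroup.lift x w * h⁻¹ := by
  have : FreeGroup.lift (fun j => h * x j * h⁻¹) =
      (MulAut.conj h).toMonoidHom.comp (FreeGroup.lift x) := by
    ext j
    simp
  rw [this]
  simp

lemma fixCount_eq_of_ne_zero (w : FreeGroup ι) {u v : V} (hu : u ≠ 0) (hv : v ≠ 0) :
    fixCount F w u = fixCount F w v := by
  obtain ⟨h, -, rfl⟩ := exists_linearEquiv_fixing (F := F) ⊥ (b := u) (b' := v)
    (by simpa using hu) (by simpa using hv)
  refine Nat.card_congr (Equiv.subtypeEquiv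
    (Equiv.piCongrRight fun _ => (MulAut.conj h).toEquiv) fun x => ?_)
  have : (Equiv.piCongrRight fun _ => (MulAut.conj h).toEquiv) x = fun j => h * x j * h⁻¹ := by
    funext j; simp
  rw [this, lift_conj]
  simp [LinearEquiv.mul_apply]

instance [Finite V] : Finite (V ≃ₗ[F] V) := DFunLike.finite _

variable [Fintype ι] [Fintype V]

lemma card_mul_fixCount (w : FreeGroup ι) {v : V} (hv : v ≠ 0) :
    Nat.card {u : V // u ≠ 0} * fixCount F w v =
      Nat.card {p : (ι → V ≃ₗ[F] V) × {u : V // u ≠ 0} //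
        FreeGroup.lift p.1 w (p.2 : V) = p.2} := by
  classical
  have e : {p : (ι → V ≃ₗ[F] V) × {u : V // u ≠ 0} // FreeGroup.lift p.1 w (p.2 : V) = p.2} ≃
      Σ u : {u : V // u ≠ 0}, {x : ι → V ≃ₗ[F] V // FreeGroup.lift x w (u : V) = u} :=
    { toFun := fun p => ⟨p.1.2, p.1.1, p.2⟩
      invFun := fun p => ⟨(p.2.1, p.1), p.2.2⟩
      left_inv := fun _ => rfl
      right_inv := fun _ => rfl }
  rw [Nat.card_congr e, Nat.card_sigma]
  have : ∀ u : {u : V // u ≠ 0},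
      Nat.card {x : ι → V ≃ₗ[F] V // FreeGroup.lift x w (u : V) = u} = fixCount F w v :=
    fun u => fixCount_eq_of_ne_zero w u.2 hv
  simp only [this, Finset.sum_const, Finset.card_univ, smul_eq_mul, Nat.card_eq_fintype_card]

lemma fixCount_conj (g w : FreeGroup ι) {v : V} (hv : v ≠ 0) :
    fixCount F (g * w * g⁻¹) v = fixCount F w v := by
  have : Nonempty {u : V // u ≠ 0} := ⟨⟨v, hv⟩⟩
  refine Nat.eq_of_mul_eq_mul_left (Nat.card_pos (α := {u : V // u ≠ 0})) ?_
  rw [card_mul_fixCount _ hv, card_mul_fixCount _ hv]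
  let e (x : ι → V ≃ₗ[F] V) : {u : V // u ≠ 0} ≃ {u : V // u ≠ 0} :=
    (FreeGroup.lift x g)⁻¹.toEquiv.subtypeEquiv fun u => by simp
  refine Nat.card_congr (Equiv.subtypeEquiv
    ((Equiv.prodShear (Equiv.refl _) e)) fun p => ?_)
  simp [e, LinearEquiv.mul_apply, LinearEquiv.eq_symm_apply]

open Classical in
lemma fixCount_wordOf_le [DecidableEq ι] [Fintype (V ≃ₗ[F] V)] {s : ℕ → ι × Bool} {l : ℕ}
    (hl : 0 < l)
    (hsl : ∀ i, s (i + l) = s i) (hs : ∀ i, s (i + 1) ≠ invLetter (s i))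
    (hpow : ¬ ∃ (u : FreeGroup ι) (m : ℕ), 2 ≤ m ∧ wordOf s l = u ^ m) {v₀ : V} (hv₀ : v₀ ≠ 0) :
    fixCount F (wordOf s l) v₀ ≤
      (Finset.univ.filter fun x : ι → V ≃ₗ[F] V =>
        edge s (traj s v₀ x) (l - 1) ∉ windowSpan F (edge s (traj s v₀ x)) 0 (l - 1) ∧
        traj s v₀ x (l - 1 + 1) = v₀).card +
      ∑ b ∈ Finset.range l, ∑ a ∈ Finset.range b,
        (Finset.univ.filter fun x : ι → V ≃ₗ[F] V =>
          Coincidence F s (traj s v₀ x) 0 a ∧ Coincidence F s (traj s v₀ x) 0 b).card := by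
  have hsub : (Finset.univ.filter fun x : ι → V ≃ₗ[F] V =>
      FreeGroup.lift x (wordOf s l) v₀ = v₀) ⊆
      (Finset.univ.filter fun x : ι → V ≃ₗ[F] V =>
        edge s (traj s v₀ x) (l - 1) ∉ windowSpan F (edge s (traj s v₀ x)) 0 (l - 1) ∧
        traj s v₀ x (l - 1 + 1) = v₀) ∪
      (Finset.range l).biUnion fun b => (Finset.range b).biUnion fun a =>
        (Finset.univ.filter fun x : ι → V ≃ₗ[F] V =>
          Coincidence F s (traj s v₀ x) 0 a ∧ Coincidence F s (traj s v₀ x) 0 b) := by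
    intro x hx
    simp only [Finset.mem_filter, Finset.mem_univ, true_and, lift_wordOf] at hx
    simp only [Finset.mem_union, Finset.mem_biUnion, Finset.mem_filter, Finset.mem_univ, true_and,
      Finset.mem_range]
    have hstep : ∀ i, traj s v₀ x (i + 1) = letterMap x (s i) (traj s v₀ x i) := fun _ => rfl
    have hvl : ∀ i, traj s v₀ x (i + l) = traj s v₀ x i := by
      intro i
      induction i with
      | zero => rw [zero_add, hx, traj]
      | succ i ih => rw [add_right_comm, hstep, hstep, ih, hsl]
    have hne : ∀ i, traj s v₀ x i ≠ 0 := by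
      intro i
      induction i with
      | zero => exact hv₀
      | succ i ih => rw [hstep]; simpa using ih
    by_cases hc : ((Finset.range l).filter fun i => Coincidence F s (traj s v₀ x) 0 i).card ≤ 1
    · left
      rcases independent_or_periodic hstep hs hl hsl hvl hne hc with h | ⟨d, hd, hdl, hsd⟩
      · refine ⟨fun he => h (l - 1) (by omega) ?_, by rw [Nat.sub_add_cancel hl, hx]⟩
        have := mem_windowSpan_of_edge_mem_of_reduced hstep hs (p := 0) (m := l - 1)
        simp only [zero_add] at this
        exact this he
      · exact absurd (wordOf_eq_pow hd hdl hsd hsl) hpow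
    · right
      obtain ⟨a, ha, b, hb, hab⟩ := Finset.one_lt_card.1 (not_le.1 hc)
      simp only [Finset.mem_filter, Finset.mem_range] at ha hb
      rcases lt_or_gt_of_ne hab with h | h
      · exact ⟨b, hb.1, a, h, ha.2, hb.2⟩
      · exact ⟨a, ha.1, b, h, hb.2, ha.2⟩
  rw [fixCount, Nat.card_eq_fintype_card, Fintype.card_subtype]
  refine (Finset.card_le_card hsub).trans ((Finset.card_union_le _ _).trans ?_)
  gcongr
  refine Finset.card_biUnion_le.trans (Finset.sum_le_sum fun b _ => ?_)
  exact Finset.card_biUnion_le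

end Counting

section Bounds

lemma le_of_sub_pow_mul_le {q n m A B β : ℕ} (hq : 2 ≤ q) (hmn : m < n)
    (h : (q ^ n - q ^ m) * A ≤ β * B) : (A : ℝ) ≤ 2 * β / (q : ℝ) ^ n * B := by
  have h₁ : 2 * q ^ m ≤ q ^ n :=
    calc 2 * q ^ m ≤ q * q ^ m := Nat.mul_le_mul_right _ hq
      _ = q ^ (m + 1) := by ring
      _ ≤ q ^ n := Nat.pow_le_pow_right (by omega) hmn
  have h₂ : q ^ n * A ≤ 2 * (β * B) := by
    have : q ^ n ≤ 2 * (q ^ n - q ^ m) := by omega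
    nlinarith
  have h₃ : (q : ℝ) ^ n * A ≤ 2 * (β * B) := by exact_mod_cast h₂
  have hpos : (0 : ℝ) < (q : ℝ) ^ n := by positivity
  rw [div_mul_eq_mul_div, le_div_iff₀ hpos]
  linarith

variable {ι F V : Type*} [DecidableEq ι] [Fintype ι] [Field F] [Fintype F] [AddCommGroup V]
  [Module F V] [Fintype V] [Fintype (V ≃ₗ[F] V)]

open Classical in
lemma card_coincidence_le (s : ℕ → ι × Bool) (v₀ : V) {n : ℕ}
    (hV : Fintype.card V = Fintype.card F ^ n) {m : ℕ} (hm : m < n) (P : (ℕ → V) → Prop)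
    (hP : ∀ u u', (∀ i ≤ m, u i = u' i) → P u → P u') :
    ((Finset.univ.filter fun x : ι → V ≃ₗ[F] V =>
      P (traj s v₀ x) ∧ Coincidence F s (traj s v₀ x) 0 m).card : ℝ) ≤
      2 * (Fintype.card F : ℝ) ^ (m + 1) / (Fintype.card F : ℝ) ^ n *
        (Finset.univ.filter fun x : ι → V ≃ₗ[F] V => P (traj s v₀ x)).card := by
  have h := card_free_step_le (F := F) s v₀ m (Fintype.card F ^ (m + 1)) P hP
    (fun u => Finset.univ.filter (· ∈ windowSpan F u 0 (m + 1)))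
    (fun u u' h => by
      rw [windowSpan_congr (F := F) (u := u) (u' := u') fun i _ hi => h i (by omega)])
    (fun u => by
      rw [← Fintype.card_subtype]
      exact card_submodule_le _ (finrank_windowSpan_le _ _ _))
  rw [hV] at h
  have h' := le_of_sub_pow_mul_le Fintype.one_lt_card hm h
  push_cast at h'
  simpa [Coincidence] using h'

open Classical in
lemma card_two_coincidences_le (s : ℕ → ι × Bool) (v₀ : V) {n l : ℕ}
    (hV : Fintype.card V = Fintype.card F ^ n) (hl : l < n) {a b : ℕ} (hab : a < b) (hb : b < l) :
    ((Finset.univ.filter fun x : ι → V ≃ₗ[F] V =>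
      Coincidence F s (traj s v₀ x) 0 a ∧ Coincidence F s (traj s v₀ x) 0 b).card : ℝ) ≤
      (2 * (Fintype.card F : ℝ) ^ l / (Fintype.card F : ℝ) ^ n) ^ 2 *
        Fintype.card (ι → V ≃ₗ[F] V) := by
  have hq : (1 : ℝ) ≤ Fintype.card F := by exact_mod_cast Fintype.card_pos
  have h₁ := card_coincidence_le (F := F) s v₀ hV (m := b) (by omega)
    (fun u => Coincidence F s u 0 a) (fun u u' h hc => hc.congr fun i hi => h i (by omega))
  have h₂ := card_coincidence_le (F := F) s v₀ hV (m := a) (by omega) (fun _ => True)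
    (fun _ _ _ h => h)
  simp only [true_and, Finset.filter_true, Finset.card_univ] at h₂
  refine (h₁.trans (mul_le_mul_of_nonneg_left h₂ (by positivity))).trans ?_
  rw [← mul_assoc, pow_two]
  gcongr <;> first | exact hq | omega

open Classical in
lemma card_closing_free_step_le (s : ℕ → ι × Bool) (v₀ : V) (m : ℕ) :
    (Fintype.card V - Fintype.card F ^ m) *
      (Finset.univ.filter fun x : ι → V ≃ₗ[F] V =>
        edge s (traj s v₀ x) m ∉ windowSpan F (edge s (traj s v₀ x)) 0 m ∧
        traj s v₀ x (m + 1) = v₀).card ≤ Fintype.card (ι → V ≃ₗ[F] V) := by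
  have h := card_free_step_le (F := F) (ι := ι) s v₀ m 1 (fun _ => True) (fun _ _ _ h => h)
    (fun _ => {v₀}) (fun _ _ _ => rfl) (fun _ => by simp)
  simpa using h

/-- The arithmetic combining the contributions of trajectories with one and with several
coincidences. -/
lemma ratio_le {q n l k : ℕ} (hq : 2 ≤ q) (hl : 0 < l) (hlk : l ≤ k) (hkn : 4 * k < n)
    {A N T : ℝ} (hN : 0 < N) (hA : ((q : ℝ) ^ n - (q : ℝ) ^ (l - 1)) * A ≤ N)
    (hT : T ≤ l ^ 2 * ((2 * (q : ℝ) ^ l / (q : ℝ) ^ n) ^ 2 * N)) :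
    (A + T) / N ≤ 1 / ((q : ℝ) ^ n - 1) * (1 + 6 * (q : ℝ) ^ (2 * (k : ℝ) - (n : ℝ) / 2)) := by
  have hq1 : (1 : ℝ) < q := by exact_mod_cast (by omega : 1 < q)
  have hq0 : (0 : ℝ) < q := by linarith
  have hlk' : (l : ℝ) ≤ k := by exact_mod_cast hlk
  have hkn' : 4 * (k : ℝ) < n := by exact_mod_cast hkn
  have hl' : (0 : ℝ) < l := by exact_mod_cast hl
  set ε := (q : ℝ) ^ (2 * (k : ℝ) - (n : ℝ) / 2)
  set Q := (q : ℝ) ^ n with hQ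
  set r := (q : ℝ) ^ l with hr
  have hQ1 : 1 < Q := one_lt_pow₀ hq1 (by omega)
  have hr1 : 1 ≤ r := one_le_pow₀ hq1.le
  have e₁ : r / Q ≤ ε := by
    rw [hr, hQ, ← Real.rpow_natCast, ← Real.rpow_natCast, ← Real.rpow_sub hq0]
    exact Real.rpow_le_rpow_of_exponent_le hq1.le (by linarith)
  have e₂ : r ^ 4 / Q ≤ ε := by
    rw [hr, hQ, ← pow_mul, ← Real.rpow_natCast, ← Real.rpow_natCast, ← Real.rpow_sub hq0]
    refine Real.rpow_le_rpow_of_exponent_le hq1.le ?_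
    push_cast
    linarith
  have hlr : (l : ℝ) ≤ r := by
    have : l ≤ q ^ l := (Nat.lt_pow_self (by omega)).le
    rw [hr]
    exact_mod_cast this
  have hp : (q : ℝ) ^ (l - 1) ≤ r := pow_le_pow_right₀ hq1.le (by omega)
  have hp1 : (1 : ℝ) ≤ (q : ℝ) ^ (l - 1) := one_le_pow₀ hq1.le
  have h2r : 2 * r ≤ Q := by
    have : 2 * q ^ l ≤ q ^ n :=
      calc 2 * q ^ l ≤ q * q ^ l := Nat.mul_le_mul_right _ hq
        _ = q ^ (l + 1) := by ring
        _ ≤ q ^ n := Nat.pow_le_pow_right (by omega) (by omega)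
    rw [hr, hQ]
    exact_mod_cast this
  have hden : 0 < Q - (q : ℝ) ^ (l - 1) := by linarith
  have hA' : A / N ≤ 1 / (Q - (q : ℝ) ^ (l - 1)) := by
    rw [div_le_div_iff₀ hN hden]
    linarith
  have hmain : 1 / (Q - (q : ℝ) ^ (l - 1)) ≤ 1 / (Q - 1) * (1 + 2 * (r / Q)) := by
    rw [div_mul_eq_mul_div, one_mul, div_le_div_iff₀ hden (by linarith)]
    have h₁ : (Q - r) * (2 * (r / Q)) ≥ r := by
      have : (Q - r) * (2 * (r / Q)) = (2 * (Q - r)) / Q * r := by ring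
      rw [this]
      have : 1 ≤ (2 * (Q - r)) / Q := by rw [le_div_iff₀ (by linarith)]; linarith
      nlinarith
    have h₂ : 0 ≤ 2 * (r / Q) := by positivity
    nlinarith
  have hT' : T / N ≤ 1 / (Q - 1) * (4 * (r ^ 4 / Q)) := by
    have h₁ : T / N ≤ l ^ 2 * (2 * r / Q) ^ 2 := by
      rw [div_le_iff₀ hN]
      linarith
    refine h₁.trans ?_
    calc (l : ℝ) ^ 2 * (2 * r / Q) ^ 2 ≤ r ^ 2 * (2 * r / Q) ^ 2 := by gcongr
      _ = 1 / Q * (4 * (r ^ 4 / Q)) := by field_simp; ring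
      _ ≤ 1 / (Q - 1) * (4 * (r ^ 4 / Q)) := by
        gcongr
        linarith
  have hc : 0 < 1 / (Q - 1) := by
    have : 0 < Q - 1 := by linarith
    positivity
  calc (A + T) / N = A / N + T / N := add_div _ _ _
    _ ≤ 1 / (Q - 1) * (1 + 2 * (r / Q)) + 1 / (Q - 1) * (4 * (r ^ 4 / Q)) :=
      add_le_add (hA'.trans hmain) hT'
    _ = 1 / (Q - 1) * (1 + 2 * (r / Q) + 4 * (r ^ 4 / Q)) := by ring
    _ ≤ 1 / (Q - 1) * (1 + 6 * ε) := by
      refine mul_le_mul_of_nonneg_left ?_ hc.le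
      linarith

/-- The probability that a word which is not a proper power fixes a given nonzero vector. -/
theorem fixCount_div_le (w : FreeGroup ι) (hw : w ≠ 1)
    (hpow : ¬ ∃ (u : FreeGroup ι) (m : ℕ), 2 ≤ m ∧ w = u ^ m) {n : ℕ}
    (hV : Fintype.card V = Fintype.card F ^ n) (hn : 4 * w.norm < n) {v : V} (hv : v ≠ 0) :
    (fixCount F w v : ℝ) / Fintype.card (ι → V ≃ₗ[F] V) ≤
      1 / ((Fintype.card F : ℝ) ^ n - 1) *
        (1 + 6 * (Fintype.card F : ℝ) ^ (2 * (w.norm : ℝ) - (n : ℝ) / 2)) := by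
  classical
  obtain ⟨g, L, hL, hlen, hconj⟩ := exists_conj_isCyclicallyReduced w
  have hL0 : L ≠ [] := by
    rintro rfl
    rw [← FreeGroup.one_eq_mk, mul_one, mul_inv_cancel] at hconj
    exact hw hconj
  obtain ⟨s, hsl, hs, hword⟩ := exists_sequence_of_isCyclicallyReduced hL0 hL
  have hl : 0 < L.length := List.length_pos_iff.2 hL0
  have hpow' : ¬ ∃ (u : FreeGroup ι) (m : ℕ), 2 ≤ m ∧ wordOf s L.length = u ^ m := by
    rintro ⟨u, m, hm, h⟩
    refine hpow ⟨g * u * g⁻¹, m, hm, ?_⟩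
    rw [conj_pow, ← h, hword, hconj]
  have hcount : fixCount F w v = fixCount F (wordOf s L.length) v := by
    rw [hword]
    conv_lhs => rw [hconj]
    exact fixCount_conj g _ hv
  have hle := fixCount_wordOf_le (F := F) hl hsl hs hpow' hv
  rw [← hcount] at hle
  set l := L.length
  have hle' := Nat.cast_le (α := ℝ).2 hle
  push_cast at hle'
  have hN : (0 : ℝ) < Fintype.card (ι → V ≃ₗ[F] V) := by exact_mod_cast Fintype.card_pos
  refine (div_le_div_of_nonneg_right hle' hN.le).trans
    (ratio_le Fintype.one_lt_card hl hlen hn hN ?_ ?_)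
  · have h := card_closing_free_step_le (F := F) s v (l - 1)
    rw [hV] at h
    have h' := Nat.cast_le (α := ℝ).2 h
    rwa [Nat.cast_mul, Nat.cast_sub (Nat.pow_le_pow_right Fintype.card_pos (by omega)),
      Nat.cast_pow, Nat.cast_pow] at h'
  · set c := (2 * (Fintype.card F : ℝ) ^ l / (Fintype.card F : ℝ) ^ n) ^ 2 *
      (Fintype.card (ι → V ≃ₗ[F] V) : ℝ)
    have hc : 0 ≤ c := by positivity
    calc _ ≤ ∑ b ∈ Finset.range l, ∑ _a ∈ Finset.range b, c :=
          Finset.sum_le_sum fun b hb => Finset.sum_le_sum fun a ha =>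
            card_two_coincidences_le s v hV (by omega) (Finset.mem_range.1 ha)
              (Finset.mem_range.1 hb)
      _ ≤ ∑ _b ∈ Finset.range l, l * c := by
          refine Finset.sum_le_sum fun b hb => ?_
          rw [Finset.sum_const, Finset.card_range, nsmul_eq_mul]
          have : b ≤ l := (Finset.mem_range.1 hb).le
          gcongr
      _ = l ^ 2 * c := by
          rw [Finset.sum_const, Finset.card_range, nsmul_eq_mul]
          ring

end Bounds

section Matrices

variable {ι F : Type*} [Field F] {n : ℕ}

/-- The identification of invertible matrices with linear automorphisms. -/
noncomputable def glEquiv (F : Type*) [Field F] (n : ℕ) :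
    GL (Fin n) F ≃* ((Fin n → F) ≃ₗ[F] (Fin n → F)) :=
  Matrix.GeneralLinearGroup.toLin.trans (LinearMap.GeneralLinearGroup.generalLinearEquiv F _)

lemma glEquiv_apply (A : GL (Fin n) F) (v : Fin n → F) :
    glEquiv F n A v = (A : Matrix (Fin n) (Fin n) F).mulVec v := rfl

lemma card_mulVec_eq_fixCount (w : FreeGroup ι) (v : Fin n → F) :
    Nat.card {x : ι → GL (Fin n) F //
      ((FreeGroup.lift x w : GL (Fin n) F) : Matrix (Fin n) (Fin n) F).mulVec v = v} =
      fixCount F w v := by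
  refine Nat.card_congr (Equiv.subtypeEquiv
    (Equiv.piCongrRight fun _ => (glEquiv F n).toEquiv) fun x => ?_)
  have : FreeGroup.lift ((Equiv.piCongrRight fun _ => (glEquiv F n).toEquiv) x) =
      (glEquiv F n).toMonoidHom.comp (FreeGroup.lift x) := by
    ext j
    simp
  rw [this, ← glEquiv_apply]
  rfl

end Matrices

end WordTrajectory

/-- **The probability that a trajectory closes** (Lemma 8.1, linear case).
There is a constant `C > 0` such that for every finite field `F_q`, every
nontrivial word `w ∈ F_k` of reduced length `ℓ < n/4` that is not a proper power,
and every nonzero `v ∈ F_q^n`: for uniformly random `x_1, …, x_k ∈ GL_n(q)`, the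
probability that `w(x_1, …, x_k)·v = v` is at most
`(1/(q^n - 1))·(1 + C·q^{2ℓ - n/2})`. -/
theorem stmt14 :
    ∃ C : ℝ, 0 < C ∧
      ∀ (F : Type) [Field F] [Fintype F] (n k : ℕ)
        (w : FreeGroup (Fin k)), w ≠ 1 →
        (¬ ∃ (u : FreeGroup (Fin k)) (m : ℕ), 2 ≤ m ∧ w = u ^ m) →
        (w.norm : ℝ) < (n : ℝ) / 4 →
        ∀ v : Fin n → F, v ≠ 0 →
          (Nat.card {x : Fin k → GL (Fin n) F //
              ((FreeGroup.lift x w : GL (Fin n) F) :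
                Matrix (Fin n) (Fin n) F).mulVec v = v} : ℝ) /
              (Nat.card (GL (Fin n) F) : ℝ) ^ k ≤
            (1 / ((Fintype.card F : ℝ) ^ n - 1)) *
              (1 + C * (Fintype.card F : ℝ) ^ (2 * (w.norm : ℝ) - (n : ℝ) / 2)) := by
  refine ⟨6, by norm_num, fun F _ _ n k w hw hpow hn v hv => ?_⟩
  classical
  have := Fintype.ofFinite ((Fin n → F) ≃ₗ[F] (Fin n → F))
  have hn' : 4 * w.norm < n := by
    have : 4 * (w.norm : ℝ) < n := by linarith
    exact_mod_cast this
  have h := WordTrajectory.fixCount_div_le (F := F) w hw hpow (by simp) hn' hv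
  rw [WordTrajectory.card_mulVec_eq_fixCount,
    Nat.card_congr (WordTrajectory.glEquiv F n).toEquiv, Nat.card_eq_fintype_card]
  simpa using h
end
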